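/- Let F be a field of characteristic p > 2, let α be a partition of n, and let β be a one-box-shift of α with β_a = α_a − 1 and β_b = α_b + 1 for a < b. Then Hom_{FΣ_n}(S^α, S^β) ≠ 0 if and only if α_a − a ≡ β_b − b (mod p), i.e. if and only if the removed node (a, α_a) and the added node (b, β_b) have the same p-residue. -/

import Mathlib

namespace CarterPayne

open Finset

/-- A partition of `n`, presented by its parts function; rows are indexed from `1`. -/
structure Partition (n : ℕ) where
  parts : ℕ → ℕ
  parts_zero : parts 0 = 0
  antitone : ∀ ⦃i j : ℕ⦄, 0 < i → i ≤ j → parts j ≤ parts i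
  finite_support : (Function.support parts).Finite
  sum_parts : ∑ᶠ i, parts i = n

variable {n : ℕ}

/-- The set of cells `(row, column)` (both 1-indexed) of the Young diagram of `μ`. -/
def Partition.cells (μ : Partition n) : Set (ℕ × ℕ) :=
  {c | 0 < c.1 ∧ 0 < c.2 ∧ c.2 ≤ μ.parts c.1}

/-- A tabloid for the composition `c` of `n`: an assignment of the `n` symbols to rows
(rows indexed from 1), row `i` receiving exactly `c i` symbols. -/
def Tabloid (n : ℕ) (c : ℕ → ℕ) : Type :=
  {g : Fin n → ℕ // ∀ i, (Finset.univ.filter fun k => g k = i).card = c i}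

/-- The permutation module `M^c` over `R`: the free `R`-module on the set of tabloids. -/
abbrev PermMod (R : Type*) [CommRing R] (n : ℕ) (c : ℕ → ℕ) := Tabloid n c →₀ R

/-- The action of a permutation of the symbols on tabloids. -/
def permTabloid (c : ℕ → ℕ) (π : Equiv.Perm (Fin n)) (f : Tabloid n c) : Tabloid n c :=
  ⟨fun k => f.1 (π.symm k), fun i => by
    rw [← f.2 i]
    exact Finset.card_equiv π.symm fun a => by simp⟩

/-- The `R`-linear action of a permutation of the symbols on `M^c`. -/
noncomputable def permM (R : Type*) [CommRing R] (c : ℕ → ℕ) (π : Equiv.Perm (Fin n)) :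
    PermMod R n c →ₗ[R] PermMod R n c :=
  Finsupp.lmapDomain R R (permTabloid c π)

/-- A bijective `μ`-tableau, presented by the placement map which sends each of the
`n` symbols to the cell of the Young diagram containing it. -/
structure Placement (μ : Partition n) where
  pos : Fin n → ℕ × ℕ
  mem : ∀ k, pos k ∈ μ.cells
  inj : Function.Injective pos
  surj : ∀ c ∈ μ.cells, ∃ k, pos k = c

/-- The column stabilizer of a bijective tableau, as a set of permutations of the symbols. -/
def colStab {μ : Partition n} (T : Placement μ) : Finset (Equiv.Perm (Fin n)) :=
  Finset.univ.filter fun π => ∀ k, (T.pos (π k)).2 = (T.pos k).2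

lemma rowFiber_card {μ : Partition n} (T : Placement μ) (i : ℕ) :
    (Finset.univ.filter fun k => (T.pos k).1 = i).card = μ.parts i := by
  classical
  have h : (Finset.univ.filter fun k => (T.pos k).1 = i).card
      = (Finset.Icc 1 (μ.parts i)).card := by
    apply Finset.card_bij (fun k _ => (T.pos k).2)
    · intro a ha
      simp only [Finset.mem_filter, Finset.mem_univ, true_and] at ha
      obtain ⟨h1, h2, h3⟩ := T.mem a
      exact Finset.mem_Icc.mpr ⟨h2, ha ▸ h3⟩
    · intro a ha b hb hab
      simp only [Finset.mem_filter, Finset.mem_univ, true_and] at ha hb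
      exact T.inj (Prod.ext (ha.trans hb.symm) hab)
    · intro j hj
      rw [Finset.mem_Icc] at hj
      have hi0 : 0 < i := by
        rcases Nat.eq_zero_or_pos i with h0 | h0
        · exfalso; rw [h0, μ.parts_zero] at hj; omega
        · exact h0
      obtain ⟨k, hk⟩ := T.surj (i, j) ⟨hi0, hj.1, hj.2⟩
      exact ⟨k, by simp [hk], by simp [hk]⟩
  rw [h, Nat.card_Icc]
  omega

/-- The row tabloid `{tπ}` associated to the bijective tableau `tπ`. -/
def rowTabloid {μ : Partition n} (T : Placement μ) (π : Equiv.Perm (Fin n)) :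
    Tabloid n μ.parts :=
  ⟨fun k => (T.pos (π k)).1, fun i => by
    rw [← rowFiber_card T i]
    exact Finset.card_equiv π fun a => by simp⟩

/-- The polytabloid `e_t` attached to a bijective tableau `t`. -/
noncomputable def polytabloid (R : Type*) [CommRing R] {μ : Partition n} (T : Placement μ) :
    PermMod R n μ.parts :=
  ∑ π ∈ colStab T, ((Equiv.Perm.sign π : ℤ) : R) • Finsupp.single (rowTabloid T π) (1 : R)

/-- The Specht module `S^μ`, the span in `M^μ` of all polytabloids. -/
noncomputable def Specht (R : Type*) [CommRing R] (μ : Partition n) :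
    Submodule R (PermMod R n μ.parts) :=
  Submodule.span R (Set.range fun T : Placement μ => polytabloid R T)

/-- `β` is obtained from the partition `α` of `n` by moving one box from
(the end of) row `a` to (the end of) row `b`; i.e. `β` is a one-box-shift of `α`. -/
structure OneBoxShift {n : ℕ} (α β : Partition n) (a b : ℕ) : Prop where
  a_pos : 0 < a
  a_lt_b : a < b
  rem : α.parts (a + 1) < α.parts a
  add : α.parts b < α.parts (b - 1)
  at_a : β.parts a = α.parts a - 1
  at_b : β.parts b = α.parts b + 1
  elsewhere : ∀ i, i ≠ a → i ≠ b → β.parts i = α.parts i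

/-- The space of `RΣ_n`-homomorphisms from `S^α` to `M^c` whose image lies in the
submodule `target` of `M^c`; an `R`-linear map is an `RΣ_n`-homomorphism when it
intertwines the permutation actions on source and target. -/
noncomputable def SpechtHom (R : Type*) [CommRing R] (α : Partition n) (c : ℕ → ℕ)
    (target : Submodule R (PermMod R n c)) :
    Submodule R (↥(Specht R α) →ₗ[R] PermMod R n c) where
  carrier := {f | (∀ x, f x ∈ target) ∧
    ∀ (π : Equiv.Perm (Fin n)) (x y : ↥(Specht R α)),
      (x : PermMod R n α.parts) = permM R α.parts π (y : PermMod R n α.parts) →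
      f x = permM R c π (f y)}
  add_mem' := by
    rintro f g ⟨hf1, hf2⟩ ⟨hg1, hg2⟩
    refine ⟨fun x => target.add_mem (hf1 x) (hg1 x), fun π x y hxy => ?_⟩
    simp only [LinearMap.add_apply, hf2 π x y hxy, hg2 π x y hxy, map_add]
  zero_mem' :=
    ⟨fun _ => target.zero_mem, fun π x y _ => by simp⟩
  smul_mem' := by
    rintro r f ⟨hf1, hf2⟩
    refine ⟨fun x => target.smul_mem r (hf1 x), fun π x y hxy => ?_⟩
    simp only [LinearMap.smul_apply, hf2 π x y hxy, map_smul]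

section Aux

/-! ### Functions on row assignments, column antisymmetrizers -/

/-- Coefficient functions on all row assignments. -/
abbrev Fn (F : Type*) (n : ℕ) := (Fin n → ℕ) → F

/-- Sign of a permutation in `F`. -/
def sg (F : Type*) [Field F] (π : Equiv.Perm (Fin n)) : F := ((Equiv.Perm.sign π : ℤ) : F)

lemma sg_mul {F : Type*} [Field F] (π σ : Equiv.Perm (Fin n)) :
    sg F (π * σ) = sg F π * sg F σ := by simp [sg]

lemma sg_inv {F : Type*} [Field F] (π : Equiv.Perm (Fin n)) :
    sg F π⁻¹ = sg F π := by simp [sg]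

lemma sg_swap {F : Type*} [Field F] {x y : Fin n} (h : x ≠ y) :
    sg F (Equiv.swap x y) = -1 := by simp [sg, Equiv.Perm.sign_swap h]

lemma sg_sq {F : Type*} [Field F] (π : Equiv.Perm (Fin n)) :
    sg F π * sg F π = 1 := by
  rw [← sg_inv, ← sg_mul]; simp [sg]

/-- The permutations preserving the column function. -/
def cst (c : Fin n → ℕ) : Finset (Equiv.Perm (Fin n)) :=
  Finset.univ.filter fun π => ∀ k, c (π k) = c k

lemma mem_cst {c : Fin n → ℕ} {π : Equiv.Perm (Fin n)} : π ∈ cst c ↔ ∀ k, c (π k) = c k := by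
  simp [cst]

/-- The column antisymmetrized row assignment `r`, with columns `c`. -/
def asym (F : Type*) [Field F] (c r : Fin n → ℕ) : Fn F n := fun h =>
  ∑ π ∈ cst c, if h = (fun k => r (π k)) then sg F π else 0

variable {F : Type*} [Field F]

lemma asym_twist (c r : Fin n → ℕ) (τ : Equiv.Perm (Fin n)) (hτ : τ ∈ cst c) :
    asym F c (fun k => r (τ k)) = sg F τ • asym F c r := by
  funext h
  simp only [asym, Pi.smul_apply, smul_eq_mul, Finset.mul_sum]
  rw [mem_cst] at hτ
  refine Finset.sum_bij' (fun π _ => τ * π) (fun π _ => τ⁻¹ * π) ?_ ?_ ?_ ?_ ?_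
  · intro π hπ
    rw [mem_cst] at hπ ⊢
    intro k
    simp [hτ, hπ]
  · intro π hπ
    rw [mem_cst] at hπ ⊢
    intro k
    have := hτ (τ⁻¹ (π k))
    simp at this
    simp [← this, hπ]
  · intro π hπ; simp
  · intro π hπ; simp
  · intro π hπ
    simp only [Equiv.Perm.mul_apply, sg_mul]
    split_ifs <;> simp [← mul_assoc, sg_sq]

lemma asym_rep (c r : Fin n → ℕ) {x y : Fin n} (hxy : x ≠ y) (hc : c x = c y) (hr : r x = r y) :
    asym F c r = 0 := by
  funext h
  simp only [asym, Pi.zero_apply]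
  refine Finset.sum_involution (fun π _ => Equiv.swap x y * π) ?_ ?_ ?_ ?_
  · intro π hπ
    have : (fun k => r ((Equiv.swap x y * π) k)) = fun k => r (π k) := by
      funext k
      simp only [Equiv.Perm.mul_apply, Equiv.swap_apply_def]
      split_ifs with h1 h2
      · rw [h1, hr]
      · rw [h2, hr]
      · rfl
    rw [this, sg_mul, sg_swap hxy]
    split_ifs <;> simp
  · intro π hπ _ h0
    have := congrArg (fun σ => σ (π⁻¹ x)) h0
    simp at this
    exact hxy this.symm
  · intro π hπ
    rw [mem_cst] at hπ ⊢
    intro k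
    rw [← hπ k]
    simp only [Equiv.Perm.mul_apply, Equiv.swap_apply_def]
    split_ifs with h1 h2
    · rw [h1, hc]
    · rw [h2, hc]
    · rfl
  · intro π hπ
    simp [← mul_assoc]

lemma asym_perm (c r : Fin n → ℕ) (σ : Equiv.Perm (Fin n)) (h : Fin n → ℕ) :
    asym F (fun k => c (σ k)) (fun k => r (σ k)) h = asym F c r (fun k => h (σ⁻¹ k)) := by
  simp only [asym]
  refine Finset.sum_bij' (fun π _ => σ * π * σ⁻¹) (fun π _ => σ⁻¹ * π * σ) ?_ ?_ ?_ ?_ ?_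
  · intro π hπ
    rw [mem_cst] at hπ ⊢
    intro k
    have := hπ (σ⁻¹ k)
    simpa using this
  · intro π hπ
    rw [mem_cst] at hπ ⊢
    intro k
    have := hπ (σ k)
    simpa using this
  · intro π hπ; simp [mul_assoc]
  · intro π hπ; simp [mul_assoc]
  · intro π hπ
    have e1 : (h = fun k => r (σ (π k))) ↔
        ((fun k => h (σ⁻¹ k)) = fun k => r ((σ * π * σ⁻¹) k)) := by
      constructor
      · intro e; funext k; rw [e]; simp
      · intro e; funext k; have := congrFun e (σ k); simpa using this
    have e2 : sg F (σ * π * σ⁻¹) = sg F π := by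
      rw [sg_mul, sg_mul, sg_inv, mul_comm (sg F σ), mul_assoc, sg_sq, mul_one]
    rw [e2]
    by_cases hh : h = fun k => r (σ (π k))
    · rw [if_pos hh, if_pos (e1.1 hh)]
    · rw [if_neg hh, if_neg (fun e => hh (e1.2 e))]

/-- The operator changing one entry `b` into an entry `a`. -/
def E (F : Type*) [Field F] {n : ℕ} (a b : ℕ) : Module.End F (Fn F n) where
  toFun v := fun h => ∑ k, if h k = a then v (Function.update h k b) else 0
  map_add' v w := by
    funext h
    simp only [Pi.add_apply, ← Finset.sum_add_distrib]
    exact Finset.sum_congr rfl fun k _ => by split_ifs <;> simp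
  map_smul' t v := by
    funext h
    simp only [Pi.smul_apply, smul_eq_mul, RingHom.id_apply, Finset.mul_sum]
    exact Finset.sum_congr rfl fun k _ => by split_ifs <;> simp

lemma E_apply (a b : ℕ) (v : Fn F n) (h : Fin n → ℕ) :
    E F a b v h = ∑ k, if h k = a then v (Function.update h k b) else 0 := rfl

/-- The operator swapping the entry `0` with every other entry. -/
def XX (F : Type*) [Field F] {n : ℕ} : Module.End F (Fn F n) where
  toFun v := fun h => ∑ k, ∑ l, if h k = 0 ∧ h l ≠ 0 then v (fun i => h (Equiv.swap k l i)) else 0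
  map_add' v w := by
    funext h
    simp only [Pi.add_apply, ← Finset.sum_add_distrib]
    exact Finset.sum_congr rfl fun k _ => Finset.sum_congr rfl fun k _ => by split_ifs <;> simp
  map_smul' t v := by
    funext h
    simp only [Pi.smul_apply, smul_eq_mul, RingHom.id_apply, Finset.mul_sum]
    exact Finset.sum_congr rfl fun k _ => Finset.sum_congr rfl fun k _ => by split_ifs <;> simp

lemma XX_apply (v : Fn F n) (h : Fin n → ℕ) :
    XX F v h = ∑ k, ∑ l, if h k = 0 ∧ h l ≠ 0 then v (fun i => h (Equiv.swap k l i)) else 0 := rfl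

/-- The sum over all pairs of swaps. -/
def ZZ (F : Type*) [Field F] {n : ℕ} : Module.End F (Fn F n) where
  toFun v := fun h => ∑ k, ∑ l, v (fun i => h (Equiv.swap k l i))
  map_add' v w := by
    funext h
    simp only [Pi.add_apply, ← Finset.sum_add_distrib]
  map_smul' t v := by
    funext h
    simp only [Pi.smul_apply, smul_eq_mul, RingHom.id_apply, Finset.mul_sum]

lemma ZZ_apply (v : Fn F n) (h : Fin n → ℕ) :
    ZZ F v h = ∑ k, ∑ l, v (fun i => h (Equiv.swap k l i)) := rfl

/-- The action of the symmetric group. -/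
def rho (F : Type*) [Field F] {n : ℕ} (σ : Equiv.Perm (Fin n)) : Module.End F (Fn F n) where
  toFun v := fun h => v (fun i => h (σ i))
  map_add' _ _ := rfl
  map_smul' _ _ := rfl

lemma rho_apply (σ : Equiv.Perm (Fin n)) (v : Fn F n) (h : Fin n → ℕ) :
    rho F σ v h = v (fun i => h (σ i)) := rfl

lemma rho_asym (c r : Fin n → ℕ) (σ : Equiv.Perm (Fin n)) :
    rho F σ (asym F c r) = asym F (fun k => c (σ⁻¹ k)) (fun k => r (σ⁻¹ k)) := by
  funext h
  rw [asym_perm, rho_apply]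
  simp

lemma rho_E (a b : ℕ) (σ : Equiv.Perm (Fin n)) (v : Fn F n) :
    rho F σ (E F a b v) = E F a b (rho F σ v) := by
  funext h
  simp only [rho_apply, E_apply]
  refine Fintype.sum_equiv σ _ _ fun k => ?_
  have : (fun i => Function.update h (σ k) b (σ i)) = Function.update (fun i => h (σ i)) k b := by
    funext i
    simp [Function.update_apply]
  rw [this]

lemma swap_conj (σ : Equiv.Perm (Fin n)) (k l i : Fin n) :
    σ (Equiv.swap k l i) = Equiv.swap (σ k) (σ l) (σ i) := by
  simp only [Equiv.swap_apply_def, EmbeddingLike.apply_eq_iff_eq]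
  split_ifs <;> rfl

lemma rho_XX (σ : Equiv.Perm (Fin n)) (v : Fn F n) :
    rho F σ (XX F v) = XX F (rho F σ v) := by
  funext h
  simp only [rho_apply, XX_apply]
  refine Fintype.sum_equiv σ _ _ fun k => Fintype.sum_equiv σ _ _ fun l => ?_
  simp only [swap_conj]

lemma rho_ZZ (σ : Equiv.Perm (Fin n)) (v : Fn F n) :
    rho F σ (ZZ F v) = ZZ F (rho F σ v) := by
  funext h
  simp only [rho_apply, ZZ_apply]
  refine Fintype.sum_equiv σ _ _ fun k => Fintype.sum_equiv σ _ _ fun l => ?_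
  simp only [swap_conj]

lemma E_asym (a b : ℕ) (c r : Fin n → ℕ) :
    E F a b (asym F c r) = ∑ m, if r m = b then asym F c (Function.update r m a) else 0 := by
  funext h
  have e1 : ∀ m, (if r m = b then asym F c (Function.update r m a) else 0) h =
      ∑ π ∈ cst c, if r m = b ∧ h = (fun k => Function.update r m a (π k)) then sg F π else 0 := by
    intro m
    by_cases hm : r m = b
    · simp [hm, asym]
    · simp [hm]
  have e2 : ∀ k, (if h k = a then asym F c r (Function.update h k b) else 0) =
      ∑ π ∈ cst c, if h k = a ∧ Function.update h k b = (fun i => r (π i)) then sg F π else 0 := by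
    intro m
    by_cases hm : h m = a
    · simp [hm, asym]
    · simp [hm]
  rw [E_apply, Finset.sum_apply]
  simp only [e1, e2]
  rw [Finset.sum_comm, Finset.sum_comm (s := Finset.univ)]
  refine Finset.sum_congr rfl fun π _ => Fintype.sum_equiv π _ _ fun k => ?_
  have : (h k = a ∧ Function.update h k b = (fun i => r (π i))) ↔
      (r (π k) = b ∧ h = (fun i => Function.update r (π k) a (π i))) := by
    simp only [funext_iff, Function.update_apply, EmbeddingLike.apply_eq_iff_eq]
    constructor
    · rintro ⟨h1, h2⟩
      refine ⟨by simpa using (h2 k).symm, fun i => ?_⟩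
      have := h2 i
      split_ifs with hi
      · rw [hi, h1]
      · simpa [hi] using this
    · rintro ⟨h1, h2⟩
      refine ⟨by simpa using (h2 k), fun i => ?_⟩
      have := h2 i
      split_ifs with hi
      · rw [hi, h1]
      · simpa [hi] using this
  simp only [this]

lemma XX_asym (c r : Fin n → ℕ) :
    XX F (asym F c r) = ∑ k, ∑ l, if r k = 0 ∧ r l ≠ 0 then
      asym F c (fun i => r (Equiv.swap k l i)) else 0 := by
  funext h
  have e1 : ∀ k l, (if r k = 0 ∧ r l ≠ 0 then
      asym F c (fun i => r (Equiv.swap k l i)) else 0) h =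
      ∑ π ∈ cst c, if (r k = 0 ∧ r l ≠ 0) ∧ h = (fun i => r (Equiv.swap k l (π i)))
        then sg F π else 0 := by
    intro k l
    by_cases hm : r k = 0 ∧ r l ≠ 0
    · simp [hm.1, hm.2, asym]
    · simp only [hm]; simp
  have e2 : ∀ k l, (if h k = 0 ∧ h l ≠ 0 then
      asym F c r (fun i => h (Equiv.swap k l i)) else 0) =
      ∑ π ∈ cst c, if (h k = 0 ∧ h l ≠ 0) ∧ (fun i => h (Equiv.swap k l i)) = (fun i => r (π i))
        then sg F π else 0 := by
    intro k l
    by_cases hm : h k = 0 ∧ h l ≠ 0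
    · simp [hm.1, hm.2, asym]
    · simp only [hm]; simp
  rw [XX_apply, Finset.sum_apply]
  simp only [Finset.sum_apply, e1, e2]
  have e3 : ∀ f : Fin n → Fin n → Equiv.Perm (Fin n) → F,
      ∑ k, ∑ l, ∑ π ∈ cst c, f k l π = ∑ π ∈ cst c, ∑ l, ∑ k, f k l π := by
    intro f
    rw [Finset.sum_comm, Finset.sum_comm (s := cst c)]
    refine Finset.sum_congr rfl fun l _ => ?_
    rw [Finset.sum_comm]
  have e4 : ∀ f : Fin n → Fin n → Equiv.Perm (Fin n) → F,
      ∑ k, ∑ l, ∑ π ∈ cst c, f k l π = ∑ π ∈ cst c, ∑ k, ∑ l, f k l π := by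
    intro f
    rw [e3]
    exact Finset.sum_congr rfl fun π _ => Finset.sum_comm
  rw [e3, e4]
  refine Finset.sum_congr rfl fun π _ => Fintype.sum_equiv π _ _ fun l =>
    Fintype.sum_equiv π _ _ fun k => ?_
  have : ((h k = 0 ∧ h l ≠ 0) ∧ (fun i => h (Equiv.swap k l i)) = (fun i => r (π i))) ↔
      ((r (π l) = 0 ∧ r (π k) ≠ 0) ∧ h = (fun i => r (Equiv.swap (π l) (π k) (π i)))) := by
    constructor
    · rintro ⟨⟨h1, h2⟩, h3⟩
      have h3' := fun i => congrFun h3 i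
      have a1 := h3' k
      have a2 := h3' l
      simp at a1 a2
      refine ⟨⟨by rw [← a2, h1], by rw [← a1]; exact h2⟩, ?_⟩
      funext i
      rw [← swap_conj, ← h3', Equiv.swap_comm l k]
      simp
    · rintro ⟨⟨h1, h2⟩, h3⟩
      have h3' := fun i => congrFun h3 i
      have a1 := h3' k
      have a2 := h3' l
      simp at a1 a2
      refine ⟨⟨by rw [a1, h1], by rw [a2]; exact h2⟩, ?_⟩
      funext i
      rw [h3', ← swap_conj, Equiv.swap_comm l k]
      simp
  simp only [this]

lemma ZZ_asym (c r : Fin n → ℕ) :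
    ZZ F (asym F c r) = ∑ k, ∑ l, asym F c (fun i => r (Equiv.swap k l i)) := by
  funext h
  rw [ZZ_apply, Finset.sum_apply]
  simp only [Finset.sum_apply, asym]
  have e4 : ∀ f : Fin n → Fin n → Equiv.Perm (Fin n) → F,
      ∑ k, ∑ l, ∑ π ∈ cst c, f k l π = ∑ π ∈ cst c, ∑ k, ∑ l, f k l π := by
    intro f
    rw [Finset.sum_comm' (t' := Finset.univ) (s' := fun _ => Finset.univ) (by simp)]
    rw [Finset.sum_comm, Finset.sum_comm (s := cst c)]
    refine Finset.sum_congr rfl fun l _ => ?_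
    rw [Finset.sum_comm]
  rw [e4, e4]
  refine Finset.sum_congr rfl fun π _ => Fintype.sum_equiv π _ _ fun k =>
    Fintype.sum_equiv π _ _ fun l => ?_
  have : ((fun i => h (Equiv.swap k l i)) = (fun i => r (π i))) ↔
      (h = (fun i => r (Equiv.swap (π k) (π l) (π i)))) := by
    constructor
    · intro h3
      have h3' := fun i => congrFun h3 i
      funext i
      rw [← swap_conj, ← h3']
      simp
    · intro h3
      have h3' := fun i => congrFun h3 i
      funext i
      rw [h3', ← swap_conj]
      simp
  simp only [this]

/-! ### The column exchange identity -/

lemma exchange (c r : Fin n → ℕ) (k0 : Fin n) (i : ℕ) (hi : i ≠ c k0) :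
    ∑ m ∈ univ.filter (fun m => Function.update c k0 i m = i),
      sg F (Equiv.swap m k0) • asym F c (fun k => r (Equiv.swap m k0 k)) =
    ∑ x ∈ univ.filter (fun x => c x = c k0),
      sg F (Equiv.swap x k0) • asym F (fun k => Function.update c k0 i (Equiv.swap x k0 k))
        (fun k => r (Equiv.swap x k0 k)) := by
  funext h
  simp only [Finset.sum_apply, Pi.smul_apply, asym_perm, smul_eq_mul]
  simp only [asym, Finset.mul_sum]
  rw [Finset.sum_sigma', Finset.sum_sigma']
  refine Finset.sum_bij'
    (fun z _ => ⟨z.2⁻¹ k0, Equiv.swap z.1 k0 * z.2 * Equiv.swap (z.2⁻¹ k0) k0⟩)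
    (fun z _ => ⟨z.2 k0, Equiv.swap (z.2 k0) k0 * z.2 * Equiv.swap z.1 k0⟩) ?_ ?_ ?_ ?_ ?_
  · rintro ⟨m, π⟩ hz
    simp only [Finset.mem_sigma, Finset.mem_filter, Finset.mem_univ, true_and, mem_cst] at hz ⊢
    obtain ⟨hm, hπ⟩ := hz
    have hx : c (π⁻¹ k0) = c k0 := by
      have := hπ (π⁻¹ k0); simpa using this.symm
    refine ⟨hx, ?_⟩
    have hxx : π (π⁻¹ k0) = k0 := by simp
    generalize π⁻¹ k0 = x at *
    intro k
    have hinj : ∀ u v, π u = π v → u = v := fun u v => π.injective.eq_iff.1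
    simp only [Equiv.Perm.mul_apply, Equiv.swap_apply_def, Function.update_apply] at hm ⊢
    grind
  · rintro ⟨x, σ⟩ hz
    simp only [Finset.mem_sigma, Finset.mem_filter, Finset.mem_univ, true_and, mem_cst] at hz ⊢
    obtain ⟨hx, hσ⟩ := hz
    have h1 := hσ k0
    refine ⟨by simpa using h1, ?_⟩
    intro k
    have hinj : ∀ u v, σ u = σ v → u = v := fun u v => σ.injective.eq_iff.1
    simp only [Equiv.Perm.mul_apply, Equiv.swap_apply_def, Function.update_apply] at hσ ⊢
    grind
  · rintro ⟨m, π⟩ hz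
    simp [mul_assoc]
  · rintro ⟨x, σ⟩ hz
    simp [mul_assoc]
  · rintro ⟨m, π⟩ hz
    simp only
    have e1 : (h = fun k => r (Equiv.swap m k0 (π k))) ↔
        ((fun k => h ((Equiv.swap (π⁻¹ k0) k0)⁻¹ k)) = fun k =>
          r ((Equiv.swap m k0 * π * Equiv.swap (π⁻¹ k0) k0) k)) := by
      constructor
      · intro e; funext k; rw [e]; simp
      · intro e; funext k
        have := congrFun e (Equiv.swap (π⁻¹ k0) k0 k)
        simpa using this
    simp only [e1]
    split_ifs
    · rw [sg_mul, sg_mul, mul_comm (sg F (Equiv.swap (π⁻¹ k0) k0)), mul_assoc, sg_sq, mul_one]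
    · simp

/-- `(c, r)` is a bijective tableau of shape `S`. -/
structure IsTab (S : ℕ → ℕ → Prop) (c r : Fin n → ℕ) : Prop where
  inj : ∀ k l, r k = r l → c k = c l → k = l
  mem : ∀ k, S (r k) (c k)
  surj : ∀ s j, S s j → ∃ k, r k = s ∧ c k = j

lemma IsTab.perm {S : ℕ → ℕ → Prop} {c r : Fin n → ℕ} (h : IsTab S c r)
    (σ : Equiv.Perm (Fin n)) : IsTab S (fun k => c (σ k)) (fun k => r (σ k)) where
  inj k l h1 h2 := σ.injective (h.inj _ _ h1 h2)
  mem k := h.mem _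
  surj s j hs := by
    obtain ⟨k, hk⟩ := h.surj s j hs
    exact ⟨σ⁻¹ k, by simpa using hk⟩

/-- Young diagram of `γ` (positive rows) plus the extra cell `(0,i)`. -/
def hat (γ : ℕ → ℕ) (i : ℕ) (s j : ℕ) : Prop := (0 < s ∧ 0 < j ∧ j ≤ γ s) ∨ (s = 0 ∧ j = i)

/-- The column filtration. -/
def KK (F : Type*) [Field F] (n : ℕ) (γ : ℕ → ℕ) (j : ℕ) : Submodule F (Fn F n) :=
  Submodule.span F {v | ∃ i c r, 0 < i ∧ i ≤ j ∧ IsTab (n := n) (hat γ i) c r ∧ v = asym F c r}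

lemma KK_mono (γ : ℕ → ℕ) {i j : ℕ} (h : i ≤ j) : KK F n γ i ≤ KK F n γ j := by
  refine Submodule.span_mono ?_
  rintro v ⟨i', c, r, h1, h2, h3⟩
  exact ⟨i', c, r, h1, h2.trans h, h3⟩

lemma asym_mem_KK {γ : ℕ → ℕ} {i j : ℕ} {c r : Fin n → ℕ} (h : IsTab (hat γ i) c r)
    (h0 : 0 < i) (h1 : i ≤ j) : asym F c r ∈ KK F n γ j :=
  Submodule.subset_span ⟨i, c, r, h0, h1, h, rfl⟩

lemma IsTab.zero {γ : ℕ → ℕ} {i : ℕ} {c r : Fin n → ℕ} (h : IsTab (hat γ i) c r) :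
    ∃ k0, r k0 = 0 ∧ c k0 = i ∧ ∀ k, r k = 0 → k = k0 := by
  obtain ⟨k0, h1, h2⟩ := h.surj 0 i (Or.inr ⟨rfl, rfl⟩)
  refine ⟨k0, h1, h2, fun k hk => h.inj _ _ (hk.trans h1.symm) ?_⟩
  rcases h.mem k with h3 | h3
  · omega
  · omega

lemma IsTab.move {γ : ℕ → ℕ} {j : ℕ} {c r : Fin n → ℕ} (h : IsTab (hat γ j) c r)
    {k0 : Fin n} (hk : r k0 = 0) (i : ℕ) : IsTab (hat γ i) (Function.update c k0 i) r where
  inj k l h1 h2 := by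
    obtain ⟨k1, h3, h4, h5⟩ := h.zero
    have := h.inj k l h1
    have a1 := h5 k
    have a2 := h5 l
    have a3 := h5 k0
    simp only [Function.update_apply] at h2
    grind
  mem k := by
    obtain ⟨k1, h3, h4, h5⟩ := h.zero
    have := h5 k
    have := h5 k0 hk
    have := h.mem k
    simp only [Function.update_apply, hat] at *
    grind
  surj s j' hs := by
    rcases hs with hs | hs
    · obtain ⟨k, h1, h2⟩ := h.surj s j' (Or.inl hs)
      refine ⟨k, h1, ?_⟩
      rw [Function.update_of_ne, h2]
      rintro rfl
      omega
    · exact ⟨k0, by omega, by simp [hs.2]⟩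

lemma exchange' {γ : ℕ → ℕ} {j : ℕ} {c r : Fin n → ℕ} (h : IsTab (hat γ j) c r)
    {k0 : Fin n} (hk : r k0 = 0) (hc : c k0 = j) {i : ℕ} (hi : 0 < i) (hij : i < j) :
    asym F c r - ∑ m ∈ univ.filter (fun m => c m = i), asym F c (fun k => r (Equiv.swap k0 m k))
      ∈ KK F n γ i := by
  have key := exchange (F := F) c r k0 i (by omega)
  have hset : univ.filter (fun m => Function.update c k0 i m = i) =
      insert k0 (univ.filter (fun m => c m = i)) := by
    ext m
    simp only [Function.update_apply, Finset.mem_filter, Finset.mem_univ, true_and,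
      Finset.mem_insert]
    by_cases hm : m = k0 <;> simp [hm]
  rw [hset, Finset.sum_insert (by simp; omega)] at key
  have e1 : ∑ m ∈ univ.filter (fun m => c m = i),
      sg F (Equiv.swap m k0) • asym F c (fun k => r (Equiv.swap m k0 k)) =
      - ∑ m ∈ univ.filter (fun m => c m = i), asym F c (fun k => r (Equiv.swap k0 m k)) := by
    rw [← Finset.sum_neg_distrib]
    refine Finset.sum_congr rfl fun m hm => ?_
    have hmk : m ≠ k0 := by
      rintro rfl
      simp at hm; omega
    rw [sg_swap hmk, Equiv.swap_comm]
    simp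
  rw [e1] at key
  have e2 : sg F (Equiv.swap k0 k0) • asym F c (fun k => r (Equiv.swap k0 k0 k)) = asym F c r := by
    simp [sg]
  rw [e2, ← sub_eq_add_neg] at key
  rw [key]
  refine Submodule.sum_mem _ fun x _ => Submodule.smul_mem _ _ ?_
  exact asym_mem_KK ((h.move hk i).perm (Equiv.swap x k0)) hi le_rfl

lemma asym_swap_zero {γ : ℕ → ℕ} {j : ℕ} {c r : Fin n → ℕ} (h : IsTab (hat γ j) c r)
    {k0 : Fin n} (hk : r k0 = 0) (hc : c k0 = j) {m : Fin n} (hm : c m ≠ j)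
    (hj : 0 < j ∧ j ≤ γ (r m)) :
    asym F c (fun k => r (Equiv.swap k0 m k)) = 0 := by
  have hm0 : 0 < r m := by
    rcases h.mem m with h1 | h1 <;> omega
  obtain ⟨q, hq1, hq2⟩ := h.surj (r m) j (Or.inl ⟨hm0, hj⟩)
  have h1 : q ≠ k0 := by rintro rfl; omega
  have h2 : q ≠ m := by rintro rfl; omega
  refine asym_rep (x := k0) (y := q) _ _ h1.symm (by omega) ?_
  rw [Equiv.swap_apply_of_ne_of_ne h1 h2]
  simp [hq1]

lemma XX_tab {γ : ℕ → ℕ} {j : ℕ} {c r : Fin n → ℕ} (h : IsTab (hat γ j) c r)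
    {k0 : Fin n} (hk : r k0 = 0) :
    XX F (asym F c r) = ∑ m ∈ univ.filter (fun m => m ≠ k0),
      asym F c (fun k => r (Equiv.swap k0 m k)) := by
  obtain ⟨k1, h1, h2, h3⟩ := h.zero
  obtain rfl := h3 _ hk
  rw [XX_asym, Finset.sum_eq_single k0, Finset.sum_filter]
  · refine Finset.sum_congr rfl fun m _ => ?_
    have : (r k0 = 0 ∧ r m ≠ 0) ↔ m ≠ k0 := by
      constructor
      · rintro ⟨_, h5⟩ rfl; omega
      · intro h5; exact ⟨h1, fun h6 => h5 (h3 _ h6)⟩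
    simp only [this]
  · intro k _ hkk
    refine Finset.sum_eq_zero fun l _ => if_neg ?_
    rintro ⟨h5, _⟩
    exact hkk (h3 _ h5)
  · simp

/-- Addable column: `X` acts by the content modulo the previous columns. -/
lemma XX_col {γ : ℕ → ℕ} (hγ : ∀ s t, s ≤ t → γ t ≤ γ s) {j : ℕ} (hj : 0 < j) {c r : Fin n → ℕ}
    (h : IsTab (hat γ j) c r) {s : ℕ} (hs : 0 < s)
    (h1 : γ s < j) (h2 : ∀ t, t < s → j ≤ γ t) :
    XX F (asym F c r) - ((j : F) - (s : F)) • asym F c r ∈ KK F n γ (j - 1) := by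
  obtain ⟨k0, hk0, hc0, huniq⟩ := h.zero
  rw [XX_tab h hk0]
  set f : Fin n → Fn F n := fun m => asym F c (fun k => r (Equiv.swap k0 m k)) with hf
  have hpos : ∀ m, 0 < c m := by
    intro m
    rcases h.mem m with h5 | h5 <;> omega
  have split : ∑ m ∈ univ.filter (fun m => m ≠ k0), f m =
      ∑ m ∈ univ.filter (fun m => m ≠ k0 ∧ c m = j), f m +
      ∑ i ∈ Ico 1 j, ∑ m ∈ univ.filter (fun m => c m = i), f m := by
    have e1 : ∑ i ∈ Ico 1 j, ∑ m ∈ univ.filter (fun m => c m = i), f m =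
        ∑ m ∈ univ.filter (fun m => c m < j), f m := by
      have := Finset.sum_fiberwise_of_maps_to (s := univ.filter (fun m => c m < j)) (t := Ico 1 j)
        (g := c) (by
          intro m hm
          simp only [Finset.mem_filter, Finset.mem_univ, true_and] at hm
          have := hpos m
          simp; omega) f
      rw [← this]
      refine Finset.sum_congr rfl fun i hi => ?_
      rw [Finset.filter_filter]
      refine Finset.sum_congr ?_ fun _ _ => rfl
      ext m
      simp at hi ⊢
      omega
    rw [e1, Finset.sum_filter, Finset.sum_filter, Finset.sum_filter, ← Finset.sum_add_distrib]
    refine Finset.sum_congr rfl fun m _ => ?_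
    by_cases hm : m = k0
    · subst hm; simp [hc0]
    · rcases lt_trichotomy (c m) j with h5 | h5 | h5
      · simp [hm, h5, h5.ne]
      · simp [hm, h5]
      · have : f m = 0 := by
          refine asym_swap_zero h hk0 hc0 h5.ne' ⟨hj, ?_⟩
          rcases h.mem m with h6 | h6
          · omega
          · exact absurd (huniq m h6.1) hm
        simp [this]
  have e2 : ∀ m ∈ univ.filter (fun m => m ≠ k0 ∧ c m = j), f m = - asym F c r := by
    intro m hm
    simp only [Finset.mem_filter, Finset.mem_univ, true_and] at hm
    have := asym_twist (F := F) c r (Equiv.swap k0 m) (by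
      rw [mem_cst]
      intro k
      rw [Equiv.swap_apply_def]
      split_ifs with a1 a2
      · rw [a1]; omega
      · rw [a2]; omega
      · rfl)
    rw [hf]
    simp only
    rw [this, sg_swap (Ne.symm hm.1)]
    simp
  have card : (univ.filter (fun m => m ≠ k0 ∧ c m = j)).card = s - 1 := by
    rw [show s - 1 = (Ico 1 s).card by simp]
    refine Finset.card_bij (fun m _ => r m) ?_ ?_ ?_
    · intro m hm
      simp only [Finset.mem_filter, Finset.mem_univ, true_and] at hm
      have a1 : r m ≠ 0 := fun h6 => hm.1 (huniq m h6)
      have a2 : j ≤ γ (r m) := by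
        rcases h.mem m with h6 | h6 <;> omega
      have a3 : r m < s := by
        by_contra h7
        have := hγ s (r m) (by omega)
        omega
      simp; omega
    · intro m hm m' hm' hr
      simp only [Finset.mem_filter, Finset.mem_univ, true_and] at hm hm'
      exact h.inj _ _ hr (by omega)
    · intro t ht
      simp at ht
      obtain ⟨m, a1, a2⟩ := h.surj t j (Or.inl ⟨by omega, hj, h2 t ht.2⟩)
      exact ⟨m, by simp [a2]; rintro rfl; omega, a1⟩
  rw [split, Finset.sum_congr rfl e2, Finset.sum_const, card]
  have e3 : ∑ i ∈ Ico 1 j, ∑ m ∈ univ.filter (fun m => c m = i), f m =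
      ((j : F) - 1) • asym F c r - ∑ i ∈ Ico 1 j, (asym F c r - ∑ m ∈ univ.filter
        (fun m => c m = i), f m) := by
    rw [Finset.sum_sub_distrib, Finset.sum_const, Nat.card_Ico, ← Nat.cast_smul_eq_nsmul F,
      Nat.cast_sub hj]
    simp
  rw [e3, ← Nat.cast_smul_eq_nsmul F, Nat.cast_sub hs]
  have e4 : ∑ i ∈ Ico 1 j, (asym F c r - ∑ m ∈ univ.filter (fun m => c m = i), f m)
      ∈ KK F n γ (j - 1) := by
    refine Submodule.sum_mem _ fun i hi => ?_
    simp at hi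
    exact KK_mono γ (by omega) (exchange' h hk0 hc0 (by omega) hi.2)
  generalize ∑ i ∈ Ico 1 j, (asym F c r - ∑ m ∈ univ.filter (fun m => c m = i), f m) = w at *
  have : ((s : F) - ((1 : ℕ) : F)) • -asym F c r + (((j : F) - 1) • asym F c r - w) -
      ((j : F) - (s : F)) • asym F c r = -w := by
    push_cast
    module
  rw [this]
  exact Submodule.neg_mem _ e4

/-- Non-addable column. -/
lemma tab_nonaddable {γ : ℕ → ℕ} {j : ℕ} (hj : 0 < j) {c r : Fin n → ℕ}
    (h : IsTab (hat γ (j + 1)) c r) (h1 : ∀ t, 0 < t → j ≤ γ t → j + 1 ≤ γ t) :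
    asym F c r ∈ KK F n γ j := by
  obtain ⟨k0, hk0, hc0, huniq⟩ := h.zero
  have := exchange' (F := F) h hk0 hc0 hj (by omega)
  rw [Finset.sum_eq_zero, sub_zero] at this
  · exact this
  · intro m hm
    simp only [Finset.mem_filter, Finset.mem_univ, true_and] at hm
    refine asym_swap_zero h hk0 hc0 (by omega) ⟨by omega, ?_⟩
    rcases h.mem m with h6 | h6
    · exact h1 _ h6.1 (by omega)
    · omega

lemma KK_collapse {γ : ℕ → ℕ} (hγ : ∀ s t, s ≤ t → γ t ≤ γ s) (t : ℕ) :
    ∀ j, γ (t + 1) + 1 ≤ j → j ≤ γ t → KK F n γ j ≤ KK F n γ (γ (t + 1) + 1) := by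
  intro j hj
  induction j, hj using Nat.le_induction with
  | base => intro _; exact le_rfl
  | succ j hj ih =>
    intro hjt
    refine le_trans ?_ (ih (by omega))
    refine Submodule.span_le.2 ?_
    rintro v ⟨i, c, r, h1, h2, h3, rfl⟩
    rcases Nat.lt_or_ge i (j + 1) with h4 | h4
    · exact asym_mem_KK h3 h1 (by omega)
    · obtain rfl : i = j + 1 := by omega
      refine tab_nonaddable (by omega) h3 fun s hs hjs => ?_
      by_contra h5
      have : s ≤ t := by
        by_contra h6
        have := hγ (t + 1) s (by omega)
        omega
      have := hγ s t this
      omega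

lemma XX_KK {γ : ℕ → ℕ} (hγ : ∀ s t, s ≤ t → γ t ≤ γ s) {B : ℕ} (hB : γ B = 0) {j : ℕ}
    (hj : j ≤ γ 0) : ∀ v ∈ KK F n γ j, XX F v ∈ KK F n γ j := by
  intro v hv
  refine Submodule.span_induction (p := fun v _ => XX F v ∈ KK F n γ j) ?_ ?_ ?_ ?_ hv
  · rintro v ⟨i, c, r, h1, h2, h3, rfl⟩
    have hex : ∃ s, γ s < i := ⟨B, by omega⟩
    classical
    have hs : 0 < Nat.find hex := by
      rw [Nat.find_pos]; omega
    have := XX_col (F := F) hγ h1 h3 hs (Nat.find_spec hex)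
      (fun t ht => by have := Nat.find_min hex ht; omega)
    have h4 := KK_mono γ (show i - 1 ≤ j by omega) this
    have h5 := Submodule.smul_mem _ ((i : F) - (Nat.find hex : F)) (asym_mem_KK (F := F) h3 h1 h2)
    simpa using Submodule.add_mem _ h4 h5
  · simp
  · intro x y _ _ hx hy
    rw [map_add]; exact Submodule.add_mem _ hx hy
  · intro a x _ hx
    rw [map_smul]; exact Submodule.smul_mem _ _ hx

lemma XX_KK_step {γ : ℕ → ℕ} (hγ : ∀ s t, s ≤ t → γ t ≤ γ s) {B : ℕ} (hB : γ B = 0)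
    (t : ℕ) (ht : γ (t + 1) < γ t) : ∀ v ∈ KK F n γ (γ t),
      XX F v - (((γ (t + 1) : F) + 1) - ((t : F) + 1)) • v ∈ KK F n γ (γ (t + 1)) := by
  intro v hv
  have hv := KK_collapse hγ t (γ t) ht le_rfl hv
  have h0t : γ t ≤ γ 0 := hγ 0 t (by omega)
  refine Submodule.span_induction
    (p := fun v _ => XX F v - (((γ (t + 1) : F) + 1) - ((t : F) + 1)) • v ∈ KK F n γ (γ (t + 1)))
    ?_ ?_ ?_ ?_ hv
  · rintro v ⟨i, c, r, h1, h2, h3, rfl⟩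
    rcases Nat.lt_or_ge i (γ (t + 1) + 1) with h4 | h4
    · have h5 := asym_mem_KK (F := F) (j := γ (t + 1)) h3 h1 (by omega)
      exact Submodule.sub_mem _ (XX_KK hγ hB (by omega) _ h5) (Submodule.smul_mem _ _ h5)
    · obtain rfl : i = γ (t + 1) + 1 := by omega
      have := XX_col (F := F) hγ h1 h3 (s := t + 1) (by omega) (by omega)
        (fun u hu => by have := hγ u t (by omega); omega)
      simpa using this
  · simp
  · intro x y _ _ hx hy
    have := Submodule.add_mem _ hx hy
    convert this using 1
    rw [map_add]; module
  · intro a x _ hx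
    have := Submodule.smul_mem _ a hx
    convert this using 1
    rw [map_smul]; module

lemma rho_KK (γ : ℕ → ℕ) (j : ℕ) (σ : Equiv.Perm (Fin n)) :
    ∀ v ∈ KK F n γ j, rho F σ v ∈ KK F n γ j := by
  intro v hv
  refine Submodule.span_induction (p := fun v _ => rho F σ v ∈ KK F n γ j) ?_ ?_ ?_ ?_ hv
  · rintro v ⟨i, c, r, h1, h2, h3, rfl⟩
    rw [rho_asym]
    exact asym_mem_KK (h3.perm σ⁻¹) h1 h2
  · simp
  · intro x y _ _ hx hy
    rw [map_add]; exact Submodule.add_mem _ hx hy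
  · intro a x _ hx
    rw [map_smul]; exact Submodule.smul_mem _ _ hx

/-! ### The row filtration -/

lemma E_kill {a b : ℕ} (hab : a ≠ b) (c r : Fin n → ℕ)
    (h : ∀ k, r k = b → ∃ k', c k' = c k ∧ r k' = a) : E F a b (asym F c r) = 0 := by
  rw [E_asym]
  refine Finset.sum_eq_zero fun m _ => ?_
  split_ifs with hm
  · obtain ⟨k', h1, h2⟩ := h m hm
    have hne : m ≠ k' := by rintro rfl; omega
    refine asym_rep (x := m) (y := k') _ _ hne h1.symm ?_
    rw [Function.update_self, Function.update_of_ne hne.symm, h2]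
  · rfl

lemma KK_induct (γ : ℕ → ℕ) (j : ℕ) (f : Fn F n →ₗ[F] Fn F n)
    (h : ∀ i c r, 0 < i → i ≤ j → IsTab (n := n) (hat γ i) c r → f (asym F c r) = 0) :
    ∀ v ∈ KK F n γ j, f v = 0 := by
  intro v hv
  have : KK F n γ j ≤ LinearMap.ker f := by
    refine Submodule.span_le.2 ?_
    rintro v ⟨i, c, r, h1, h2, h3, rfl⟩
    exact h i c r h1 h2 h3
  exact this hv

lemma KK_hw {γ : ℕ → ℕ} (hγ : ∀ s t, s ≤ t → γ t ≤ γ s) {j : ℕ} {a b : ℕ} (ha : 0 < a)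
    (hab : a < b) : ∀ v ∈ KK F n γ j, E F a b v = 0 := by
  refine KK_induct γ j _ fun i c r h1 h2 h3 => E_kill hab.ne _ _ fun k hk => ?_
  have := hγ a b hab.le
  rcases h3.mem k with h4 | h4
  · rw [hk] at h4
    obtain ⟨k', a1, a2⟩ := h3.surj a (c k) (Or.inl ⟨ha, h4.2.1, by omega⟩)
    exact ⟨k', a2, a1⟩
  · omega

lemma KK_eq {γ : ℕ → ℕ} {j : ℕ} {t : ℕ} (ht : 0 < t)
    (hab : γ (t + 1) = γ t) : ∀ v ∈ KK F n γ j, E F (t + 1) t v = 0 := by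
  refine KK_induct γ j _ fun i c r h1 h2 h3 => E_kill (by omega) _ _ fun k hk => ?_
  rcases h3.mem k with h4 | h4
  · rw [hk] at h4
    obtain ⟨k', a1, a2⟩ := h3.surj (t + 1) (c k) (Or.inl ⟨by omega, h4.2.1, by omega⟩)
    exact ⟨k', a2, a1⟩
  · omega

lemma KK_row {γ : ℕ → ℕ} {j : ℕ} {s : ℕ} (hs : 0 < s) (hj : j ≤ γ s) :
    ∀ v ∈ KK F n γ j, E F s 0 v = 0 := by
  refine KK_induct γ j _ fun i c r h1 h2 h3 => E_kill (by omega) _ _ fun k hk => ?_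
  rcases h3.mem k with h4 | h4
  · omega
  · obtain ⟨k', a1, a2⟩ := h3.surj s i (Or.inl ⟨hs, h1, by omega⟩)
    exact ⟨k', by omega, a1⟩

lemma asym_ne_zero {c r h : Fin n → ℕ} (hh : asym F c r h ≠ 0) :
    ∃ π ∈ cst c, h = fun k => r (π k) := by
  by_contra hcon
  push Not at hcon
  apply hh
  exact Finset.sum_eq_zero fun π hπ => if_neg (hcon π hπ)

/-- The weight condition. -/
def Wt (γ : ℕ → ℕ) (h : Fin n → ℕ) : Prop :=
  (∃ k0, h k0 = 0 ∧ ∀ k, h k = 0 → k = k0) ∧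
    ∀ s, 0 < s → (univ.filter fun k => h k = s).card = γ s

lemma KK_wt {γ : ℕ → ℕ} {j : ℕ} : ∀ v ∈ KK F n γ j, ∀ h, ¬ Wt γ h → v h = 0 := by
  intro v hv h hh
  refine Submodule.span_induction (p := fun v _ => v h = 0) ?_ ?_ ?_ ?_ hv
  · rintro v ⟨i, c, r, h1, h2, h3, rfl⟩
    by_contra hne
    apply hh
    obtain ⟨π, hπ, rfl⟩ := asym_ne_zero hne
    refine ⟨?_, fun s hs => ?_⟩
    · obtain ⟨k0, a1, a2, a3⟩ := h3.zero
      refine ⟨π⁻¹ k0, by simpa using a1, fun k hk => ?_⟩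
      have := a3 _ hk
      rw [← this]; simp
    · rw [show γ s = (Icc 1 (γ s)).card by simp]
      refine Finset.card_bij (fun k _ => c (π k)) ?_ ?_ ?_
      · intro k hk
        simp only [Finset.mem_filter, Finset.mem_univ, true_and] at hk
        rcases h3.mem (π k) with h6 | h6
        · rw [hk] at h6; simp; omega
        · omega
      · intro k hk l hl hkl
        simp only [Finset.mem_filter, Finset.mem_univ, true_and] at hk hl
        exact π.injective (h3.inj _ _ (hk.trans hl.symm) hkl)
      · intro t ht
        simp only [Finset.mem_Icc] at ht
        obtain ⟨k, a1, a2⟩ := h3.surj s t (Or.inl ⟨hs, ht⟩)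
        exact ⟨π⁻¹ k, by simp [a1], by simp [a2]⟩
  · rfl
  · intro x y _ _ hx hy
    simp [hx, hy]
  · intro a x _ hx
    simp [hx]

/-- The row filtration. -/
def NN (F : Type*) [Field F] (n : ℕ) (γ : ℕ → ℕ) (t : ℕ) : Submodule F (Fn F n) where
  carrier := {v | v ∈ KK F n γ (γ 0) ∧ ∀ s, 0 < s → s ≤ t → E F s 0 v = 0}
  add_mem' := by
    rintro x y ⟨h1, h2⟩ ⟨h3, h4⟩
    exact ⟨Submodule.add_mem _ h1 h3, fun s hs ht => by rw [map_add, h2 s hs ht, h4 s hs ht, add_zero]⟩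
  zero_mem' := ⟨Submodule.zero_mem _, fun s _ _ => map_zero _⟩
  smul_mem' := by
    rintro a x ⟨h1, h2⟩
    exact ⟨Submodule.smul_mem _ _ h1, fun s hs ht => by rw [map_smul, h2 s hs ht, smul_zero]⟩

lemma mem_NN {γ : ℕ → ℕ} {t : ℕ} {v : Fn F n} : v ∈ NN F n γ t ↔
    v ∈ KK F n γ (γ 0) ∧ ∀ s, 0 < s → s ≤ t → E F s 0 v = 0 := Iff.rfl

lemma KK_le_NN {γ : ℕ → ℕ} (hγ : ∀ s t, s ≤ t → γ t ≤ γ s) (t : ℕ) :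
    KK F n γ (γ t) ≤ NN F n γ t := by
  intro v hv
  refine ⟨KK_mono γ (hγ 0 t (by omega)) hv, fun s hs hst => KK_row hs (hγ s t hst) v hv⟩

lemma NN_nonaddable {γ : ℕ → ℕ} {t : ℕ} (ht : 0 < t)
    (h : γ (t + 1) = γ t) : NN F n γ t ≤ NN F n γ (t + 1) := by
  rintro v ⟨h1, h2⟩
  refine ⟨h1, fun s hs hst => ?_⟩
  rcases Nat.lt_or_ge s (t + 1) with h3 | h3
  · exact h2 s hs (by omega)
  obtain rfl : s = t + 1 := by omega
  have k1 := KK_eq ht h v h1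
  have k2 := h2 t ht le_rfl
  funext g
  have e1 : ∀ k, g k = t + 1 → v (Function.update g k 0) +
      ∑ l, (if g l = t then v (Function.update (Function.update g k t) l 0) else 0) = 0 := by
    intro k hk
    have := congrFun k2 (Function.update g k t)
    rw [E_apply, ← Finset.add_sum_erase _ _ (Finset.mem_univ k)] at this
    simp only [Function.update_self, if_true, Function.update_idem, Pi.zero_apply] at this
    rw [← Finset.add_sum_erase _ _ (Finset.mem_univ k), if_neg (by omega), zero_add]
    refine Eq.trans ?_ this
    congr 1
    refine Finset.sum_congr rfl fun l hl => ?_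
    rw [Function.update_of_ne (Finset.ne_of_mem_erase hl)]
  have e2 : ∀ l, g l = t → ∑ k, (if g k = t + 1 then
      v (Function.update (Function.update g k t) l 0) else 0) = 0 := by
    intro l hl
    have := congrFun k1 (Function.update g l 0)
    rw [E_apply] at this
    simp only [Pi.zero_apply] at this
    refine Eq.trans ?_ this
    refine Finset.sum_congr rfl fun k _ => ?_
    by_cases hkl : k = l
    · subst hkl; simp [hl]
    · rw [Function.update_of_ne hkl, Function.update_comm hkl]
  rw [E_apply, Pi.zero_apply]
  calc _ = ∑ k, (if g k = t + 1 then - ∑ l, (if g l = t then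
          v (Function.update (Function.update g k t) l 0) else 0) else 0) := by
        refine Finset.sum_congr rfl fun k _ => ?_
        split_ifs with hk
        · exact eq_neg_of_add_eq_zero_left (e1 k hk)
        · rfl
    _ = - ∑ l, ∑ k, (if g l = t then (if g k = t + 1 then
          v (Function.update (Function.update g k t) l 0) else 0) else 0) := by
        rw [Finset.sum_comm, ← Finset.sum_neg_distrib]
        refine Finset.sum_congr rfl fun k _ => ?_
        split_ifs with hk
        · rfl
        · simp
    _ = 0 := by
        rw [neg_eq_zero]
        refine Finset.sum_eq_zero fun l _ => ?_
        by_cases hl : g l = t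
        · simp only [hl, if_true]; exact e2 l hl
        · simp [hl]

lemma card_update {g : Fin n → ℕ} {l : Fin n} {r : ℕ} (hr : 0 < r) (hl : g l = r) :
    (univ.filter fun k => g k = r).card =
      (univ.filter fun k => Function.update g l 0 k = r).card + 1 := by
  have : univ.filter (fun k => g k = r) =
      insert l (univ.filter fun k => Function.update g l 0 k = r) := by
    ext k
    by_cases hk : k = l
    · simp [hk, hl]
    · simp [hk]
  rw [this, Finset.card_insert_of_notMem]
  simp; omega

lemma XX_row {γ : ℕ → ℕ} (hγ : ∀ s t, s ≤ t → γ t ≤ γ s) {t : ℕ} (v : Fn F n)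
    (hv : v ∈ NN F n γ t) :
    E F (t + 1) 0 (XX F v) = (((γ (t + 1) : F) + 1) - ((t : F) + 1)) • E F (t + 1) 0 v := by
  obtain ⟨hK, hN⟩ := hv
  have hwt := KK_wt v hK
  funext g
  rw [Pi.smul_apply, smul_eq_mul, E_apply, E_apply]
  by_cases hz : ∃ z, g z = 0
  · -- `g` already contains a zero
    obtain ⟨z, hz⟩ := hz
    have bad : ∀ k, g k = t + 1 → ∀ σ : Equiv.Perm (Fin n),
        v (fun i => Function.update g k 0 (σ i)) = 0 := by
      intro k hk σ
      apply hwt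
      rintro ⟨⟨k0, -, h2⟩, -⟩
      have hzk : z ≠ k := by rintro rfl; omega
      have a1 := h2 (σ⁻¹ k) (by simp)
      have a2 := h2 (σ⁻¹ z) (by simp [hzk, hz])
      exact hzk (σ⁻¹.injective (a2.trans a1.symm))
    rw [Finset.sum_eq_zero, Finset.sum_eq_zero, mul_zero]
    · intro k _
      split_ifs with hk
      · exact bad k hk 1
      · rfl
    · intro k _
      split_ifs with hk
      · rw [XX_apply]
        refine Finset.sum_eq_zero fun x _ => Finset.sum_eq_zero fun y _ => ?_
        split_ifs
        · exact bad k hk _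
        · rfl
      · rfl
  · push Not at hz
    set G : Fin n → Fin n → (Fin n → ℕ) := fun k l =>
      Function.update (Function.update g k (g l)) l 0 with hG
    have e1 : ∀ k, g k = t + 1 → XX F v (Function.update g k 0) =
        ∑ l, v (G k l) - v (Function.update g k 0) := by
      intro k hk
      rw [XX_apply, Finset.sum_eq_single k]
      · rw [← Finset.add_sum_erase _ _ (Finset.mem_univ k),
          ← Finset.add_sum_erase (a := k) _ (fun l => v (G k l)) (Finset.mem_univ k)]
        have : G k k = Function.update g k 0 := by simp [hG]
        rw [this, add_sub_cancel_left, if_neg (by simp), zero_add]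
        refine Finset.sum_congr rfl fun l hl => ?_
        have hlk := Finset.ne_of_mem_erase hl
        rw [if_pos (by simp [hlk, hz])]
        congr 1
        funext i
        simp only [hG, Equiv.swap_apply_def, Function.update_apply]
        split_ifs <;> simp_all
      · intro k' _ hk'
        refine Finset.sum_eq_zero fun l _ => if_neg ?_
        rintro ⟨a1, -⟩
        rw [Function.update_of_ne hk'] at a1
        exact hz _ a1
      · simp
    have eA : ∑ l ∈ univ.filter (fun l => g l = t + 1), ∑ k, (if g k = t + 1 then v (G k l) else 0)
        = ((γ (t + 1) : F) + 1) * ∑ k, (if g k = t + 1 then v (Function.update g k 0) else 0) := by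
      rw [Finset.mul_sum, Finset.sum_filter]
      refine Finset.sum_congr rfl fun l _ => ?_
      split_ifs with hl
      · have : ∀ k, (if g k = t + 1 then v (G k l) else 0) =
            if g k = t + 1 then v (Function.update g l 0) else 0 := by
          intro k
          split_ifs with hk
          · congr 1
            simp only [hG, hl, ← hk, Function.update_eq_self]
          · rfl
        simp only [this]
        rw [← Finset.sum_filter, Finset.sum_const, nsmul_eq_mul]
        by_cases hw : Wt γ (Function.update g l 0)
        · rw [card_update (by omega) hl, hw.2 _ (by omega)]
          push_cast; ring
        · rw [hwt _ hw, mul_zero, mul_zero]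
      · simp
    have eB : ∑ l ∈ univ.filter (fun l => t + 1 < g l), ∑ k, (if g k = t + 1 then v (G k l) else 0)
        = 0 := by
      refine Finset.sum_eq_zero fun l hl => ?_
      simp only [Finset.mem_filter, Finset.mem_univ, true_and] at hl
      have := congrFun (KK_hw hγ (a := t + 1) (by omega) hl v hK) (Function.update g l 0)
      rw [E_apply, Pi.zero_apply] at this
      refine Eq.trans ?_ this
      refine Finset.sum_congr rfl fun k _ => ?_
      by_cases hkl : k = l
      · subst hkl
        rw [if_neg (by omega), if_neg (by simp)]
      · simp only [hG]; rw [Function.update_of_ne hkl, Function.update_comm hkl]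
    have eC : ∑ l ∈ univ.filter (fun l => g l < t + 1), ∑ k, (if g k = t + 1 then v (G k l) else 0)
        = - (t : F) * ∑ k, (if g k = t + 1 then v (Function.update g k 0) else 0) := by
      rw [Finset.sum_comm, Finset.mul_sum]
      refine Finset.sum_congr rfl fun k _ => ?_
      by_cases hk : g k = t + 1
      · simp only [hk, if_true]
        rw [← Finset.sum_fiberwise_of_maps_to (t := Icc 1 t) (g := g)]
        · have : ∀ s ∈ Icc 1 t, ∑ l ∈ (univ.filter (fun l => g l < t + 1)).filter (fun l => g l = s),
              v (G k l) = - v (Function.update g k 0) := by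
            intro s hs
            simp only [Finset.mem_Icc] at hs
            have := congrFun (hN s (by omega) hs.2) (Function.update g k s)
            rw [E_apply, ← Finset.add_sum_erase _ _ (Finset.mem_univ k)] at this
            simp only [Function.update_self, if_true, Function.update_idem, Pi.zero_apply] at this
            rw [eq_neg_iff_add_eq_zero, add_comm]
            refine Eq.trans ?_ this
            congr 1
            rw [Finset.filter_filter, Finset.sum_filter,
              ← Finset.add_sum_erase _ _ (Finset.mem_univ k), if_neg (by omega), zero_add]
            refine Finset.sum_congr rfl fun l hl => ?_
            have hlk := Finset.ne_of_mem_erase hl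
            rw [Function.update_of_ne hlk]
            by_cases hls : g l = s
            · rw [if_pos (by omega), if_pos hls, hG]
              simp only [hls]
            · rw [if_neg (by omega), if_neg hls]
          rw [Finset.sum_congr rfl this, Finset.sum_const, Nat.card_Icc, nsmul_eq_mul]
          simp
        · intro l hl
          simp only [Finset.mem_filter, Finset.mem_univ, true_and] at hl
          have := hz l
          simp; omega
      · simp [hk]
    have split : ∑ k, (if g k = t + 1 then XX F v (Function.update g k 0) else 0) =
        (∑ l ∈ univ.filter (fun l => g l = t + 1), ∑ k, (if g k = t + 1 then v (G k l) else 0) +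
        ∑ l ∈ univ.filter (fun l => t + 1 < g l), ∑ k, (if g k = t + 1 then v (G k l) else 0) +
        ∑ l ∈ univ.filter (fun l => g l < t + 1), ∑ k, (if g k = t + 1 then v (G k l) else 0)) -
        ∑ k, (if g k = t + 1 then v (Function.update g k 0) else 0) := by
      have s1 : ∑ k, (if g k = t + 1 then XX F v (Function.update g k 0) else 0) =
          ∑ l, ∑ k, (if g k = t + 1 then v (G k l) else 0) -
          ∑ k, (if g k = t + 1 then v (Function.update g k 0) else 0) := by
        rw [Finset.sum_comm, ← Finset.sum_sub_distrib]
        refine Finset.sum_congr rfl fun k _ => ?_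
        split_ifs with hk
        · exact e1 k hk
        · simp
      rw [s1]
      congr 1
      simp only [Finset.sum_filter]
      rw [← Finset.sum_add_distrib, ← Finset.sum_add_distrib]
      refine Finset.sum_congr rfl fun l _ => ?_
      rcases lt_trichotomy (g l) (t + 1) with h5 | h5 | h5
      · simp [h5, h5.ne, h5.le]
      · simp [h5]
      · rw [if_neg h5.ne', if_pos h5, if_neg (by omega)]; simp
    rw [split, eA, eB, eC]
    ring

lemma XX_NN_step {γ : ℕ → ℕ} (hγ : ∀ s t, s ≤ t → γ t ≤ γ s) {B : ℕ} (hB : γ B = 0) (t : ℕ) :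
    ∀ v ∈ NN F n γ t,
      XX F v - (((γ (t + 1) : F) + 1) - ((t : F) + 1)) • v ∈ NN F n γ (t + 1) := by
  intro v hv
  refine ⟨Submodule.sub_mem _ (XX_KK hγ hB le_rfl v hv.1) (Submodule.smul_mem _ _ hv.1), ?_⟩
  intro s hs hst
  obtain ⟨u, rfl⟩ : ∃ u, s = u + 1 := ⟨s - 1, by omega⟩
  have hu : v ∈ NN F n γ u := ⟨hv.1, fun s' h1 h2 => hv.2 s' h1 (by omega)⟩
  rw [map_sub, map_smul, XX_row hγ v hu]
  rcases Nat.lt_or_ge u t with h3 | h3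
  · rw [hv.2 (u + 1) (by omega) (by omega)]; simp
  · obtain rfl : u = t := by omega
    simp

lemma NN_bot {γ : ℕ → ℕ} {B : ℕ} (hB0 : 0 < B) (hB : γ B = 0) : ∀ v ∈ NN F n γ B, v = 0 := by
  intro v hv
  funext g
  by_cases hw : Wt γ g
  · obtain ⟨⟨k0, h1, h2⟩, h3⟩ := hw
    have := congrFun (hv.2 B hB0 le_rfl) (Function.update g k0 B)
    rw [E_apply, Finset.sum_eq_single k0] at this
    · simpa [← h1] using this
    · intro k _ hk
      rw [Function.update_of_ne hk, if_neg]
      intro h4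
      have h5 := h3 B hB0
      rw [hB, Finset.card_eq_zero] at h5
      have : k ∈ univ.filter (fun k => g k = B) := by simp [h4]
      rw [h5] at this
      simp at this
    · simp
  · exact KK_wt v hv.1 g hw

/-! ### Polynomials in the swap operator -/

/-- The linear factor attached to an addable row. -/
noncomputable def qq (F : Type*) [Field F] (γ : ℕ → ℕ) (t : ℕ) : Polynomial F :=
  if γ (t + 1) < γ t then Polynomial.X - Polynomial.C (((γ (t + 1) : F) + 1) - ((t : F) + 1)) else 1

lemma qq_monic (γ : ℕ → ℕ) (t : ℕ) : (qq F γ t).Monic := by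
  unfold qq
  split_ifs
  · exact Polynomial.monic_X_sub_C _
  · exact Polynomial.monic_one

lemma qq_natDegree (γ : ℕ → ℕ) (t : ℕ) :
    (qq F γ t).natDegree = if γ (t + 1) < γ t then 1 else 0 := by
  unfold qq
  split_ifs
  · exact Polynomial.natDegree_X_sub_C _
  · exact Polynomial.natDegree_one

lemma aeval_qq_pos {γ : ℕ → ℕ} {t : ℕ} (h : γ (t + 1) < γ t) (v : Fn F n) :
    Polynomial.aeval (XX F (n := n)) (qq F γ t) v =
      XX F v - (((γ (t + 1) : F) + 1) - ((t : F) + 1)) • v := by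
  rw [qq, if_pos h, map_sub, Polynomial.aeval_X, Polynomial.aeval_C]
  rfl

lemma aeval_qq_neg {γ : ℕ → ℕ} {t : ℕ} (h : ¬ γ (t + 1) < γ t) (v : Fn F n) :
    Polynomial.aeval (XX F (n := n)) (qq F γ t) v = v := by
  rw [qq, if_neg h, map_one]
  rfl

lemma aeval_chain (γ : ℕ → ℕ) (V : ℕ → Submodule F (Fn F n))
    (hV : ∀ t, ∀ v ∈ V t, Polynomial.aeval (XX F (n := n)) (qq F γ t) v ∈ V (t + 1))
    {t1 t2 : ℕ} (h : t1 ≤ t2) : ∀ v ∈ V t1,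
      Polynomial.aeval (XX F (n := n)) (∏ t ∈ Ico t1 t2, qq F γ t) v ∈ V t2 := by
  induction t2, h using Nat.le_induction with
  | base => intro v hv; simpa using hv
  | succ t ht ih =>
    intro v hv
    rw [Finset.prod_Ico_succ_top ht, mul_comm, map_mul, Module.End.mul_apply]
    exact hV t _ (ih v hv)

lemma KK_chain {γ : ℕ → ℕ} (hγ : ∀ s t, s ≤ t → γ t ≤ γ s) {B : ℕ} (hB : γ B = 0)
    {t1 t2 : ℕ} (h : t1 ≤ t2) : ∀ v ∈ KK F n γ (γ t1),
      Polynomial.aeval (XX F (n := n)) (∏ t ∈ Ico t1 t2, qq F γ t) v ∈ KK F n γ (γ t2) := by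
  refine aeval_chain γ (fun t => KK F n γ (γ t)) (fun t v hv => ?_) h
  by_cases h1 : γ (t + 1) < γ t
  · rw [aeval_qq_pos h1]
    exact XX_KK_step hγ hB t h1 v hv
  · rw [aeval_qq_neg h1]
    have : γ (t + 1) = γ t := le_antisymm (hγ _ _ (by omega)) (by omega)
    simpa only [this] using hv

lemma NN_chain {γ : ℕ → ℕ} (hγ : ∀ s t, s ≤ t → γ t ≤ γ s) (h0 : γ 1 < γ 0) {B : ℕ} (hB : γ B = 0)
    {t1 t2 : ℕ} (h : t1 ≤ t2) : ∀ v ∈ NN F n γ t1,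
      Polynomial.aeval (XX F (n := n)) (∏ t ∈ Ico t1 t2, qq F γ t) v ∈ NN F n γ t2 := by
  refine aeval_chain γ (fun t => NN F n γ t) (fun t v hv => ?_) h
  by_cases h1 : γ (t + 1) < γ t
  · rw [aeval_qq_pos h1]
    exact XX_NN_step hγ hB t v hv
  · rw [aeval_qq_neg h1]
    have h2 : γ (t + 1) = γ t := le_antisymm (hγ _ _ (by omega)) (by omega)
    have h3 : 0 < t := by
      rcases Nat.eq_zero_or_pos t with rfl | h3
      · simp at h2; omega
      · exact h3
    exact NN_nonaddable h3 h2 hv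

/-! ### Nonvanishing -/

/-- The entries which are missing in their own column. -/
def miss (c r g : Fin n → ℕ) : Finset (Fin n) :=
  univ.filter fun k => r k ≠ 0 ∧ ∀ k', c k' = c k → g k' ≠ r k

lemma mem_miss {c r g : Fin n → ℕ} {k : Fin n} :
    k ∈ miss c r g ↔ r k ≠ 0 ∧ ∀ k', c k' = c k → g k' ≠ r k := by simp [miss]

lemma pow_miss {c r : Fin n → ℕ} (hinj : ∀ k l, r k = r l → c k = c l → k = l) (e : ℕ) :
    ∀ g : Fin n → ℕ, e < (miss c r g).card → ((XX F) ^ e) (asym F c r) g = 0 := by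
  induction e with
  | zero =>
    intro g hg
    by_contra hne
    obtain ⟨π, hπ, rfl⟩ := asym_ne_zero hne
    obtain ⟨k, hk⟩ := Finset.card_pos.1 hg
    rw [mem_miss] at hk
    rw [mem_cst] at hπ
    refine hk.2 (π⁻¹ k) ?_ (by simp)
    have := hπ (π⁻¹ k)
    simpa using this.symm
  | succ e ih =>
    intro g hg
    rw [pow_succ', Module.End.mul_apply, XX_apply]
    refine Finset.sum_eq_zero fun z _ => Finset.sum_eq_zero fun l _ => ?_
    split_ifs with h
    · apply ih
      have hzl : z ≠ l := by rintro rfl; exact h.2 h.1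
      have key : ∀ m ∈ miss c r g \ miss c r (fun i => g (Equiv.swap z l i)),
          c z = c m ∧ g l = r m := by
        intro m hm
        rw [Finset.mem_sdiff, mem_miss, mem_miss] at hm
        obtain ⟨⟨h1, h2⟩, h3⟩ := hm
        push Not at h3
        obtain ⟨k', h4, h5⟩ := h3 h1
        have h6 := h2 k' h4
        by_cases hz : k' = z
        · subst hz
          rw [Equiv.swap_apply_left] at h5
          exact ⟨h4, h5⟩
        · by_cases hl : k' = l
          · subst hl
            rw [Equiv.swap_apply_right, h.1] at h5
            exact absurd h5.symm h1
          · rw [Equiv.swap_apply_of_ne_of_ne hz hl] at h5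
            exact absurd h5 h6
      have h1 : (miss c r g \ miss c r (fun i => g (Equiv.swap z l i))).card ≤ 1 := by
        rw [Finset.card_le_one]
        intro m hm m' hm'
        have a1 := key m hm
        have a2 := key m' hm'
        exact hinj _ _ (a1.2.symm.trans a2.2) (a1.1.symm.trans a2.1)
      have h2 := Finset.card_le_card_sdiff_add_card (t := miss c r (fun i => g (Equiv.swap z l i)))
        (s := miss c r g)
      omega
    · rfl

/-- Number of removable rows up to `ρ`. -/
def DD (γ : ℕ → ℕ) (ρ : ℕ) : ℕ := ((Icc 1 ρ).filter fun t => γ (t + 1) < γ t).card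

lemma DD_succ (γ : ℕ → ℕ) (ρ : ℕ) :
    DD γ (ρ + 1) = DD γ ρ + if γ (ρ + 2) < γ (ρ + 1) then 1 else 0 := by
  unfold DD
  rw [← Finset.insert_Icc_right_eq_Icc_add_one (by omega), Finset.filter_insert]
  split_ifs with h
  · rw [Finset.card_insert_of_notMem (by simp)]
  · rfl

lemma asym_self {c r : Fin n → ℕ} (hinj : ∀ k l, r k = r l → c k = c l → k = l) :
    asym F c r r = 1 := by
  unfold asym
  rw [Finset.sum_eq_single 1]
  · simp [sg]
  · intro π hπ hne
    rw [if_neg]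
    intro h
    apply hne
    rw [mem_cst] at hπ
    ext k
    have := hinj (π k) k (congrFun h k).symm (hπ k)
    simp [this]
  · intro h; exact absurd (mem_cst.2 fun k => rfl) h

lemma detect {γ : ℕ → ℕ} (hγ : ∀ s t, s ≤ t → γ t ≤ γ s) (h0 : γ 1 < γ 0) {c r : Fin n → ℕ}
    (h : IsTab (hat γ (γ 0)) c r) (ρ : ℕ) :
    ∃ (g : Fin n → ℕ) (z : Fin n) (S : Finset (Fin n)),
      g z = 0 ∧ (∀ k, g k = 0 → k = z) ∧ (∀ k, ρ < r k → g k = r k) ∧ (∀ k, r k ≤ ρ → g k ≤ ρ) ∧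
      (∀ k, c k = c z → r k ≤ ρ) ∧ S ⊆ miss c r g ∧ S.card = DD γ ρ ∧
      (∀ m ∈ S, ∀ k, c k = c m → r k ≤ ρ) ∧ ((XX F) ^ (DD γ ρ)) (asym F c r) g = 1 := by
  induction ρ with
  | zero =>
    obtain ⟨k0, h1, h2, h3⟩ := h.zero
    refine ⟨r, k0, ∅, h1, h3, fun _ _ => rfl, fun _ h => h, ?_, by simp, by simp [DD], by simp, ?_⟩
    · intro k hk
      rcases h.mem k with h4 | h4
      · have := hγ 1 (r k) h4.1
        omega
      · omega
    · simpa [DD] using asym_self h.inj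
  | succ ρ ih =>
    obtain ⟨g, z, S, gz, gu, ghi, glo, zc, Sm, Sc, Scol, hX⟩ := ih
    rw [DD_succ]
    split_ifs with hrem
    · obtain ⟨z', rz', cz'⟩ := h.surj (ρ + 1) (γ (ρ + 1)) (Or.inl ⟨by omega, by omega, le_rfl⟩)
      have rz : r z ≤ ρ := zc z rfl
      have hzz : z ≠ z' := by rintro rfl; omega
      have czz : c z ≠ c z' := by intro e; have := zc z' e.symm; omega
      have gz' : g z' = ρ + 1 := by rw [ghi z' (by omega), rz']
      have grow : ∀ k, g k = ρ + 1 → r k = ρ + 1 := by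
        intro k hk
        rcases Nat.lt_or_ge ρ (r k) with h1 | h1
        · rw [← ghi k h1, hk]
        · have := glo k h1; omega
      have Sr : ∀ m ∈ S, r m ≤ ρ := fun m hm => Scol m hm m rfl
      have Sne : ∀ m ∈ S, ∀ k, r k = ρ + 1 → c k ≠ c m := by
        intro m hm k hk e
        have := Scol m hm k e
        omega
      set gn : Fin n → ℕ := fun i => g (Equiv.swap z z' i) with hgn
      have gnz : gn z = ρ + 1 := by simp [hgn, gz']
      have gnzp : gn z' = 0 := by simp [hgn, gz]
      have gno : ∀ k, k ≠ z → k ≠ z' → gn k = g k := fun k h1 h2 => by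
        simp only [hgn]; rw [Equiv.swap_apply_of_ne_of_ne h1 h2]
      have gnu : ∀ k, gn k = 0 → k = z' := by
        intro k hk
        have := gu _ hk
        rw [Equiv.swap_apply_eq_iff, Equiv.swap_apply_left] at this
        exact this
      have zS : z' ∉ S := fun hm => by have := Sr z' hm; omega
      refine ⟨gn, z', insert z' S, gnzp, gnu, ?_, ?_, ?_, ?_, ?_, ?_, ?_⟩
      · intro k hk
        rw [gno k (by rintro rfl; omega) (by rintro rfl; omega), ghi k (by omega)]
      · intro k hk
        by_cases h1 : k = z
        · subst h1; omega
        by_cases h2 : k = z'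
        · subst h2; omega
        rw [gno k h1 h2]
        rcases Nat.lt_or_ge ρ (r k) with h3 | h3
        · rw [ghi k h3]; exact hk
        · have := glo k h3; omega
      · intro k hk
        by_contra hcon
        rcases h.mem k with h4 | h4
        · have := hγ (ρ + 2) (r k) (by omega)
          omega
        · omega
      · intro m hm
        rw [mem_miss]
        rcases Finset.mem_insert.1 hm with rfl | hm
        · refine ⟨by omega, fun k hk => ?_⟩
          by_cases h1 : k = z
          · subst h1; exact absurd hk czz
          by_cases h2 : k = m
          · subst h2; omega
          rw [gno k h1 h2]
          intro h3
          exact h2 (h.inj _ _ (by rw [grow k (by omega), rz']) hk)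
        · have h5 := mem_miss.1 (Sm hm)
          have h6 := Sr m hm
          refine ⟨h5.1, fun k hk => ?_⟩
          by_cases h1 : k = z
          · subst h1; omega
          by_cases h2 : k = z'
          · subst h2; omega
          rw [gno k h1 h2]
          exact h5.2 k hk
      · rw [Finset.card_insert_of_notMem zS, Sc]
      · intro m hm k hk
        rcases Finset.mem_insert.1 hm with rfl | hm
        · by_contra hcon
          rcases h.mem k with h4 | h4
          · have := hγ (ρ + 2) (r k) (by omega)
            omega
          · omega
        · have := Scol m hm k hk; omega
      · rw [pow_succ', Module.End.mul_apply, XX_apply, Finset.sum_eq_single z', Finset.sum_eq_single z]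
        · rw [if_pos ⟨gnzp, by omega⟩, ← hX]
          refine congrArg _ (funext fun i => ?_)
          simp only [hgn]
          rw [Equiv.swap_comm z' z, Equiv.swap_apply_self]
        · intro l _ hlz
          split_ifs with hl
          · have hlz' : l ≠ z' := by rintro rfl; exact hl.2 hl.1
            have gl : gn l = g l := gno l hlz hlz'
            set f : Fin n → ℕ := fun i => gn (Equiv.swap z' l i) with hf
            have fz' : f z' = g l := by simp [hf, gl]
            have fl : f l = 0 := by simp [hf, gnzp]
            have fz : f z = ρ + 1 := by
              simp only [hf]; rw [Equiv.swap_apply_of_ne_of_ne hzz (Ne.symm hlz), gnz]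
            have fo : ∀ k, k ≠ z → k ≠ z' → k ≠ l → f k = g k := fun k h1 h2 h3 => by
              simp only [hf]; rw [Equiv.swap_apply_of_ne_of_ne h2 h3, gno k h1 h2]
            have Smf : S ⊆ miss c r f := by
              intro m hm
              have h5 := mem_miss.1 (Sm hm)
              have h6 := Sr m hm
              refine mem_miss.2 ⟨h5.1, fun k hk => ?_⟩
              by_cases h1 : k = z
              · subst h1; omega
              by_cases h2 : k = z'
              · subst h2; exact absurd hk (Sne m hm _ rz')
              by_cases h3 : k = l
              · subst h3; omega
              rw [fo k h1 h2 h3]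
              exact h5.2 k hk
            apply pow_miss h.inj
            rw [← Sc]
            by_cases hgl : g l = ρ + 1
            · have rl := grow l hgl
              have lS : l ∉ S := fun hm => by have := Sr l hm; omega
              rw [Nat.lt_iff_add_one_le, ← Finset.card_insert_of_notMem lS]
              refine Finset.card_le_card (Finset.insert_subset (mem_miss.2 ⟨by omega, fun k hk => ?_⟩) Smf)
              by_cases h1 : k = z
              · subst h1; have := zc l hk.symm; omega
              by_cases h2 : k = z'
              · subst h2; exact absurd (h.inj l k (by omega) hk.symm) hlz'
              by_cases h3 : k = l
              · subst h3; omega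
              rw [fo k h1 h2 h3]
              intro h7
              exact h3 (h.inj k l (by rw [grow k (by omega), rl]) hk)
            · rw [Nat.lt_iff_add_one_le, ← Finset.card_insert_of_notMem zS]
              refine Finset.card_le_card (Finset.insert_subset (mem_miss.2 ⟨by omega, fun k hk => ?_⟩) Smf)
              by_cases h1 : k = z
              · subst h1; exact absurd hk czz
              by_cases h2 : k = z'
              · subst h2; omega
              by_cases h3 : k = l
              · subst h3; omega
              rw [fo k h1 h2 h3]
              intro h7
              exact h2 (h.inj k z' (by rw [grow k (by omega), rz']) hk)
          · rfl
        · simp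
        · intro k _ hk
          refine Finset.sum_eq_zero fun l _ => if_neg ?_
          rintro ⟨h1, -⟩
          exact hk (gnu k h1)
        · simp
    · refine ⟨g, z, S, gz, gu, fun k hk => ghi k (by omega), fun k hk => ?_,
        fun k hk => (zc k hk).trans (by omega), Sm, Sc,
        fun m hm k hk => (Scol m hm k hk).trans (by omega), hX⟩
      rcases Nat.lt_or_ge ρ (r k) with h3 | h3
      · rw [ghi k h3]; exact hk
      · have := glo k h3; omega

lemma nonvanish {γ : ℕ → ℕ} (hγ : ∀ s t, s ≤ t → γ t ≤ γ s) (h0 : γ 1 < γ 0) {c r : Fin n → ℕ}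
    (h : IsTab (hat γ (γ 0)) c r) (ρ : ℕ) (q : Polynomial F) (hq : q.Monic)
    (hd : q.natDegree = DD γ ρ) :
    Polynomial.aeval (XX F (n := n)) q (asym F c r) ≠ 0 := by
  obtain ⟨g, z, S, -, -, -, -, -, Sm, Sc, -, hX⟩ := detect (F := F) hγ h0 h ρ
  intro hz
  have := congrFun hz g
  rw [Polynomial.aeval_eq_sum_range, LinearMap.sum_apply, Finset.sum_apply,
    Finset.sum_range_succ, Finset.sum_eq_zero, hd] at this
  · simp only [LinearMap.smul_apply, Pi.smul_apply, ← hd, hq.coeff_natDegree] at this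
    rw [hd, hX] at this
    simp at this
  · intro e he
    rw [Finset.mem_range, hd, ← Sc] at he
    simp only [LinearMap.smul_apply, Pi.smul_apply]
    rw [pow_miss h.inj e g (he.trans_le (Finset.card_le_card Sm)), smul_zero]

/-! ### Construction of the homomorphism -/

/-- The shape `γ` with one extra box in row `a`. -/
def shp (γ : ℕ → ℕ) (a : ℕ) (s j : ℕ) : Prop :=
  0 < s ∧ 0 < j ∧ j ≤ γ s + if s = a then 1 else 0

/-- The Specht module, inside the space of functions. -/
def SS (F : Type*) [Field F] (n : ℕ) (γ : ℕ → ℕ) (a : ℕ) : Submodule F (Fn F n) :=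
  Submodule.span F {v | ∃ c r, IsTab (n := n) (shp γ a) c r ∧ v = asym F c r}

lemma E_tab {γ : ℕ → ℕ} {i s : ℕ} {c r : Fin n → ℕ} (h : IsTab (hat γ i) c r) {k0 : Fin n}
    (hk : r k0 = 0) : E F s 0 (asym F c r) = asym F c (Function.update r k0 s) := by
  obtain ⟨k1, h1, h2, h3⟩ := h.zero
  rw [E_asym, Finset.sum_eq_single k0, if_pos hk]
  · intro k _ hne
    rw [if_neg]
    intro h4
    exact hne ((h3 k h4).trans (h3 k0 hk).symm)
  · simp

lemma IsTab.up {γ : ℕ → ℕ} {a : ℕ} (ha : 0 < a) {c r : Fin n → ℕ}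
    (h : IsTab (hat γ (γ a + 1)) c r) {k0 : Fin n} (hk : r k0 = 0) :
    IsTab (shp γ a) c (Function.update r k0 a) := by
  obtain ⟨k1, h1, h2, h3⟩ := h.zero
  obtain rfl := h3 _ hk
  have hc : ∀ k, k ≠ k0 → 0 < r k ∧ 0 < c k ∧ c k ≤ γ (r k) := by
    intro k hk
    rcases h.mem k with h4 | h4
    · exact h4
    · exact absurd (h3 k h4.1) hk
  refine ⟨fun k l e1 e2 => ?_, fun k => ?_, fun s j hs => ?_⟩
  · by_cases hk0 : k = k0
    · by_cases hl0 : l = k0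
      · rw [hk0, hl0]
      · subst hk0
        have := hc l hl0
        rw [Function.update_self, Function.update_of_ne hl0] at e1
        rw [← e1] at this; omega
    · by_cases hl0 : l = k0
      · subst hl0
        have := hc k hk0
        rw [Function.update_self, Function.update_of_ne hk0] at e1
        rw [e1] at this; omega
      · rw [Function.update_of_ne hk0, Function.update_of_ne hl0] at e1
        exact h.inj _ _ e1 e2
  · by_cases hk0 : k = k0
    · subst hk0
      rw [Function.update_self]
      refine ⟨ha, by omega, by simp [h2]⟩
    · have := hc k hk0
      rw [Function.update_of_ne hk0]
      exact ⟨this.1, this.2.1, by omega⟩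
  · by_cases hj : j ≤ γ s
    · obtain ⟨k, e1, e2⟩ := h.surj s j (Or.inl ⟨hs.1, hs.2.1, hj⟩)
      have : k ≠ k0 := by rintro rfl; have := hs.1; omega
      exact ⟨k, by rw [Function.update_of_ne this, e1], e2⟩
    · have h5 := hs.2.2
      split_ifs at h5 with h6
      · subst h6
        exact ⟨k0, by simp, by omega⟩
      · omega

lemma IsTab.down {γ : ℕ → ℕ} {a : ℕ} (ha : 0 < a) {c r : Fin n → ℕ}
    (h : IsTab (shp γ a) c r) :
    ∃ k0, r k0 = a ∧ c k0 = γ a + 1 ∧ IsTab (hat γ (γ a + 1)) c (Function.update r k0 0) := by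
  obtain ⟨k0, h1, h2⟩ := h.surj a (γ a + 1) ⟨ha, by omega, by simp⟩
  refine ⟨k0, h1, h2, fun k l e1 e2 => ?_, fun k => ?_, fun s j hs => ?_⟩
  · by_cases hk0 : k = k0
    · by_cases hl0 : l = k0
      · rw [hk0, hl0]
      · subst hk0
        have := h.mem l
        rw [Function.update_self, Function.update_of_ne hl0] at e1
        have := this.1; omega
    · by_cases hl0 : l = k0
      · subst hl0
        have := h.mem k
        rw [Function.update_self, Function.update_of_ne hk0] at e1
        have := this.1; omega
      · rw [Function.update_of_ne hk0, Function.update_of_ne hl0] at e1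
        exact h.inj _ _ e1 e2
  · by_cases hk0 : k = k0
    · subst hk0
      rw [Function.update_self]
      exact Or.inr ⟨rfl, h2⟩
    · obtain ⟨e1, e2, e3⟩ := h.mem k
      rw [Function.update_of_ne hk0]
      refine Or.inl ⟨e1, e2, ?_⟩
      split_ifs at e3 with h6
      · by_contra hcon
        exact hk0 (h.inj _ _ (by omega) (by rw [h6] at e3 hcon; omega))
      · exact e3
  · rcases hs with hs | hs
    · obtain ⟨k, e1, e2⟩ := h.surj s j ⟨hs.1, hs.2.1, by omega⟩
      have : k ≠ k0 := by
        rintro rfl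
        have : s = a := by omega
        subst this; omega
      exact ⟨k, by rw [Function.update_of_ne this, e1], e2⟩
    · exact ⟨k0, by simp [hs.1], by omega⟩

lemma E_KK_SS {γ : ℕ → ℕ} {a : ℕ} (ha : 0 < a) :
    ∀ v ∈ KK F n γ (γ a + 1), E F a 0 v ∈ SS F n γ a := by
  intro v hv
  have : KK F n γ (γ a + 1) ≤ (SS F n γ a).comap (E F a 0) := by
    refine Submodule.span_le.2 ?_
    rintro v ⟨i, c, r, h1, h2, h3, rfl⟩
    rw [SetLike.mem_coe, Submodule.mem_comap]
    rcases Nat.lt_or_ge (γ a) i with h4 | h4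
    · obtain rfl : i = γ a + 1 := by omega
      obtain ⟨k0, e1, e2, e3⟩ := h3.zero
      rw [E_tab h3 e1]
      exact Submodule.subset_span ⟨_, _, h3.up ha e1, rfl⟩
    · rw [KK_row ha le_rfl _ (asym_mem_KK h3 h1 h4)]
      exact Submodule.zero_mem _
  exact this hv

lemma E_KK_onto {γ : ℕ → ℕ} {a : ℕ} (ha : 0 < a) :
    ∀ w ∈ SS F n γ a, ∃ v ∈ KK F n γ (γ a + 1), E F a 0 v = w := by
  intro w hw
  have : SS F n γ a ≤ (KK F n γ (γ a + 1)).map (E F a 0) := by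
    refine Submodule.span_le.2 ?_
    rintro v ⟨c, r, h, rfl⟩
    obtain ⟨k0, h1, h2, h3⟩ := h.down ha
    refine ⟨_, asym_mem_KK h3 (by omega) le_rfl, ?_⟩
    rw [E_tab h3 (k0 := k0) (by simp)]
    simp [← h1]
  exact this hw

lemma rho_SS (γ : ℕ → ℕ) (a : ℕ) (σ : Equiv.Perm (Fin n)) :
    ∀ v ∈ SS F n γ a, rho F σ v ∈ SS F n γ a := by
  intro v hv
  have : SS F n γ a ≤ (SS F n γ a).comap (rho F σ) := by
    refine Submodule.span_le.2 ?_
    rintro v ⟨c, r, h, rfl⟩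
    rw [SetLike.mem_coe, Submodule.mem_comap, rho_asym]
    exact Submodule.subset_span ⟨_, _, h.perm σ⁻¹, rfl⟩
  exact this hv

lemma rho_aeval (σ : Equiv.Perm (Fin n)) (q : Polynomial F) (v : Fn F n) :
    rho F σ (Polynomial.aeval (XX F (n := n)) q v) =
      Polynomial.aeval (XX F (n := n)) q (rho F σ v) := by
  have h : Commute (rho F σ) (XX F (n := n)) := LinearMap.ext fun v => rho_XX σ v
  have h2 : Commute (rho F σ) (Polynomial.aeval (XX F (n := n)) q) := by
    refine Polynomial.induction_on q ?_ ?_ ?_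
    · intro a; rw [Polynomial.aeval_C]; exact (Algebra.commutes a _).symm
    · intro p q hp hq; rw [map_add]; exact hp.add_right hq
    · intro k a _
      rw [map_mul, Polynomial.aeval_C, map_pow, Polynomial.aeval_X]
      exact Commute.mul_right (Algebra.commutes a _).symm (h.pow_right _)
  exact LinearMap.congr_fun h2 v

lemma DD_eq_sum (γ : ℕ → ℕ) (B : ℕ) :
    DD γ B = ∑ t ∈ Ico 1 (B + 1), if γ (t + 1) < γ t then 1 else 0 := by
  rw [DD, Finset.card_filter]
  rfl

theorem hom_exists {γ : ℕ → ℕ} (hγ : ∀ s t, s ≤ t → γ t ≤ γ s) (h0 : γ 1 < γ 0)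
    {a b B : ℕ} (ha0 : 0 < a) (hab : a < b) (hbB : b ≤ B) (hB : γ B = 0)
    (ha : γ a < γ (a - 1)) (hb : γ b < γ (b - 1))
    (hres : ((γ a : F) + 1) - a = ((γ b : F) + 1) - b)
    (hex : ∃ c r : Fin n → ℕ, IsTab (hat γ (γ 0)) c r) :
    ∃ U : SS F n γ a →ₗ[F] Fn F n, (∀ w, U w ∈ SS F n γ b) ∧
      (∀ (σ : Equiv.Perm (Fin n)) (x y : SS F n γ a), (x : Fn F n) = rho F σ (y : Fn F n) →
        U x = rho F σ (U y)) ∧ U ≠ 0 := by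
  set P : Polynomial F := ∏ t ∈ Ico (a - 1) (b - 1), qq F γ t with hP
  have hPQ : P = ∏ t ∈ Ico a b, qq F γ t := by
    obtain ⟨a, rfl⟩ : ∃ u, a = u + 1 := ⟨a - 1, by omega⟩
    obtain ⟨b, rfl⟩ : ∃ u, b = u + 1 := ⟨b - 1, by omega⟩
    simp only [Nat.add_sub_cancel] at *
    rw [hP, Finset.prod_eq_prod_Ico_succ_bot (by omega), Finset.prod_Ico_succ_top (by omega),
      mul_comm]
    congr 1
    rw [qq, qq, if_pos ha, if_pos hb]
    push_cast at hres
    rw [hres]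
  have hKA : KK F n γ (γ a + 1) ≤ KK F n γ (γ (a - 1)) := KK_mono γ (by omega)
  have hAK : KK F n γ (γ (a - 1)) ≤ KK F n γ (γ a + 1) := by
    have := KK_collapse (F := F) (n := n) hγ (a - 1) (γ (a - 1))
    rw [Nat.sub_add_cancel ha0] at this
    exact this (by omega) le_rfl
  have hBK : KK F n γ (γ (b - 1)) ≤ KK F n γ (γ b + 1) := by
    have := KK_collapse (F := F) (n := n) hγ (b - 1) (γ (b - 1))
    rw [Nat.sub_add_cancel (by omega)] at this
    exact this (by omega) le_rfl
  set ψ : Module.End F (Fn F n) := E F b 0 * Polynomial.aeval (XX F (n := n)) P with hψ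
  have hψa : ∀ v, ψ v = E F b 0 (Polynomial.aeval (XX F (n := n)) P v) := fun v => rfl
  have p1 : ∀ v ∈ KK F n γ (γ a + 1), ψ v ∈ SS F n γ b := by
    intro v hv
    exact E_KK_SS (by omega) _ (hBK (KK_chain hγ hB (by omega) v (hKA hv)))
  have p2 : ∀ v ∈ KK F n γ (γ a + 1), E F a 0 v = 0 → ψ v = 0 := by
    intro v hv hE
    have h1 : v ∈ NN F n γ a := by
      refine ⟨KK_mono γ (hγ 0 (a - 1) (by omega)) (hKA hv), fun s hs hsa => ?_⟩
      rcases Nat.lt_or_ge s a with h2 | h2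
      · exact KK_row hs (hγ s (a - 1) (by omega)) v (hKA hv)
      · obtain rfl : s = a := by omega
        exact hE
    have h2 := NN_chain hγ h0 hB hab.le v h1
    rw [← hPQ] at h2
    exact h2.2 b (by omega) le_rfl
  have p3 : ∀ σ v, rho F σ (ψ v) = ψ (rho F σ v) := by
    intro σ v
    rw [hψa, hψa, rho_E, rho_aeval]
  have p4 : ∃ y ∈ KK F n γ (γ a + 1), ψ y ≠ 0 := by
    obtain ⟨c, r, h⟩ := hex
    have m0 : asym F c r ∈ KK F n γ (γ 0) := asym_mem_KK h (by omega) le_rfl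
    have m1 := KK_chain hγ hB (Nat.zero_le (a - 1)) _ m0
    refine ⟨_, hAK m1, fun hz => ?_⟩
    rw [hψa, ← Module.End.mul_apply (Polynomial.aeval (XX F (n := n)) P), ← map_mul, hP, mul_comm,
      Finset.prod_Ico_consecutive _ (by omega) (by omega)] at hz
    have m2 := KK_le_NN hγ (b - 1) (KK_chain hγ hB (Nat.zero_le (b - 1)) _ m0)
    have m3 : Polynomial.aeval (XX F (n := n)) (∏ t ∈ Ico 0 (b - 1), qq F γ t) (asym F c r) ∈
        NN F n γ b := by
      refine ⟨m2.1, fun s hs hsb => ?_⟩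
      rcases Nat.lt_or_ge s b with h2 | h2
      · exact m2.2 s hs (by omega)
      · obtain rfl : s = b := by omega
        exact hz
    have m4 := NN_bot (by omega) hB _ (NN_chain hγ h0 hB hbB _ m3)
    rw [← Module.End.mul_apply, ← map_mul] at m4
    refine nonvanish hγ h0 h (B - 1) _ ?_ ?_ m4
    · exact (Polynomial.monic_prod_of_monic _ _ fun t _ => qq_monic γ t).mul
        (Polynomial.monic_prod_of_monic _ _ fun t _ => qq_monic γ t)
    · rw [(Polynomial.monic_prod_of_monic _ _ fun t _ => qq_monic γ t).natDegree_mul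
        (Polynomial.monic_prod_of_monic _ _ fun t _ => qq_monic γ t),
        Polynomial.natDegree_prod_of_monic _ _ (fun t _ => qq_monic γ t),
        Polynomial.natDegree_prod_of_monic _ _ (fun t _ => qq_monic γ t), DD_eq_sum,
        Nat.sub_add_cancel (by omega)]
      simp only [qq_natDegree]
      have s1 := Finset.sum_eq_sum_Ico_succ_bot (show 0 < B by omega)
        (fun t => if γ (t + 1) < γ t then 1 else 0)
      have s2 := Finset.sum_Ico_consecutive (fun t => if γ (t + 1) < γ t then 1 else 0)
        (Nat.zero_le b) hbB
      have s3 := Finset.sum_Ico_succ_top (Nat.zero_le (b - 1))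
        (fun t => if γ (t + 1) < γ t then 1 else 0)
      rw [Nat.sub_add_cancel (by omega), if_pos hb] at s3
      rw [if_pos (by simpa using h0)] at s1
      simp only [Nat.zero_add] at s1
      omega
  set f : KK F n γ (γ a + 1) →ₗ[F] SS F n γ a :=
    (E F a 0).restrict (E_KK_SS ha0) with hf
  have hsurj : Function.Surjective f := by
    rintro ⟨w, hw⟩
    obtain ⟨v, hv, e⟩ := E_KK_onto ha0 w hw
    exact ⟨⟨v, hv⟩, Subtype.ext e⟩
  obtain ⟨g, hg⟩ := f.exists_rightInverse_of_surjective (LinearMap.range_eq_top.2 hsurj)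
  have hU : ∀ (v : Fn F n) (hv : v ∈ KK F n γ (γ a + 1)) (w : SS F n γ a), E F a 0 v = w →
      ψ (g w) = ψ v := by
    intro v hv w hvw
    rw [← sub_eq_zero, ← map_sub]
    refine p2 _ (Submodule.sub_mem _ (g w).2 hv) ?_
    rw [map_sub, hvw, sub_eq_zero]
    exact congrArg Subtype.val (LinearMap.congr_fun hg w)
  refine ⟨ψ ∘ₗ (Submodule.subtype _) ∘ₗ g, fun w => p1 _ (g w).2, fun σ x y hxy => ?_, ?_⟩
  · change ψ (g x) = rho F σ (ψ (g y))
    rw [p3]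
    refine hU _ (rho_KK _ _ _ _ (g y).2) x ?_
    rw [← rho_E, hxy]
    congr 1
    exact congrArg Subtype.val (LinearMap.congr_fun hg y)
  · obtain ⟨y, hy, hne⟩ := p4
    intro hz
    apply hne
    rw [← hU y hy ⟨E F a 0 y, E_KK_SS ha0 y hy⟩ rfl]
    exact LinearMap.congr_fun hz _

/-! ### The central element acts by contents -/

/-- The Young diagram of a sequence of parts. -/
def yd (μ : ℕ → ℕ) (s j : ℕ) : Prop := 0 < s ∧ 0 < j ∧ j ≤ μ s

lemma pair_count (u w : Fin n → ℕ) (hinj : ∀ k l, u k = u l → w k = w l → k = l)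
    (hc : ∀ k, (univ.filter fun l => u l = u k ∧ w l ≤ w k).card = w k) :
    ∑ k, ∑ l, (if u k = u l then (1 : F) else 0) = ∑ k, (2 * (w k : F) - 1) := by
  have e1 : ∀ k l, (if u k = u l then (1 : F) else 0) =
      (if u l = u k ∧ w l ≤ w k then 1 else 0) + (if u k = u l ∧ w k ≤ w l then 1 else 0)
        - (if k = l then 1 else 0) := by
    intro k l
    by_cases h1 : u k = u l
    · by_cases h2 : k = l
      · subst h2; simp
      · have h3 : w k ≠ w l := fun h => h2 (hinj _ _ h1 h)
        rcases lt_or_gt_of_ne h3 with h4 | h4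
        · simp [h1, h2, h4.le, Nat.not_le.2 h4]
        · simp [h1, h2, h4.le, Nat.not_le.2 h4]
    · have h2 : k ≠ l := by rintro rfl; exact h1 rfl
      simp [h1, h2, Ne.symm h1]
  have e2 : ∀ k, ∑ l, (if u l = u k ∧ w l ≤ w k then (1 : F) else 0) = w k := by
    intro k
    rw [Finset.sum_boole, hc k]
  simp only [e1, Finset.sum_sub_distrib, Finset.sum_add_distrib]
  rw [Finset.sum_comm (f := fun k l => if u k = u l ∧ w k ≤ w l then (1 : F) else 0)]
  simp only [e2, Finset.sum_ite_eq, Finset.mem_univ, if_true]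
  rw [← Finset.mul_sum]
  ring

lemma ZZ_tab {μ : ℕ → ℕ} (hμ : ∀ s t, 0 < s → s ≤ t → μ t ≤ μ s) {c r : Fin n → ℕ}
    (h : IsTab (yd μ) c r) :
    ZZ F (asym F c r) = ((n : F) + 2 * ∑ k, ((c k : F) - (r k : F))) • asym F c r := by
  have half : ∀ k l, c l < c k → asym F c (fun i => r (Equiv.swap k l i)) =
      (if r k = r l then (1 : F) else 0) • asym F c r := by
    intro k l hlt
    split_ifs with hr
    · rw [one_smul]
      congr 1
      funext i
      rw [Equiv.swap_apply_def]
      split_ifs with h1 h2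
      · rw [h1, hr]
      · rw [h2, hr]
      · rfl
    · rw [zero_smul]
      have hk := h.mem k
      have hl := h.mem l
      obtain ⟨m, m1, m2⟩ := h.surj (r k) (c l) ⟨hk.1, hl.2.1, hlt.le.trans hk.2.2⟩
      have hml : l ≠ m := by rintro rfl; exact hr m1.symm
      have hmk : m ≠ k := by rintro rfl; omega
      refine asym_rep (x := l) (y := m) _ _ hml m2.symm ?_
      rw [Equiv.swap_apply_right, Equiv.swap_apply_of_ne_of_ne hmk hml.symm, m1]
  have key : ∀ k l, asym F c (fun i => r (Equiv.swap k l i)) =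
      ((if r k = r l then (1 : F) else 0) - (if c k = c l then 1 else 0) +
        (if k = l then 1 else 0)) • asym F c r := by
    intro k l
    by_cases hkl : k = l
    · subst hkl
      simp
    rw [if_neg hkl, add_zero]
    rcases lt_trichotomy (c k) (c l) with h1 | h1 | h1
    · rw [if_neg h1.ne, sub_zero, Equiv.swap_comm, half l k h1]
      simp only [eq_comm]
    · have h2 : r k ≠ r l := fun h2 => hkl (h.inj _ _ h2 h1)
      rw [if_neg h2, if_pos h1, zero_sub, ← sg_swap (F := F) hkl]
      refine asym_twist c r _ (mem_cst.2 fun i => ?_)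
      rw [Equiv.swap_apply_def]
      split_ifs with h3 h4
      · rw [h3, h1]
      · rw [h4, h1]
      · rfl
    · rw [if_neg h1.ne', sub_zero, half k l h1]
  rw [ZZ_asym]
  simp only [key, ← Finset.sum_smul]
  congr 1
  simp only [Finset.sum_add_distrib, Finset.sum_sub_distrib]
  rw [pair_count r c (fun k l h1 h2 => h.inj k l h1 h2), pair_count c r (fun k l h1 h2 => h.inj k l h2 h1)]
  · simp only [Finset.sum_sub_distrib, Finset.sum_ite_eq, Finset.mem_univ, if_true, ← Finset.mul_sum]
    simp
    ring
  · intro k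
    have hk := h.mem k
    conv_rhs => rw [show r k = (Icc 1 (r k)).card by simp]
    refine Finset.card_bij (fun l _ => r l) ?_ ?_ ?_
    · intro l hl
      simp only [Finset.mem_filter, Finset.mem_univ, true_and] at hl
      have := (h.mem l).1
      simp; omega
    · intro l hl m hm hlm
      simp only [Finset.mem_filter, Finset.mem_univ, true_and] at hl hm
      exact h.inj _ _ hlm (hl.1.trans hm.1.symm)
    · intro s hs
      simp only [Finset.mem_Icc] at hs
      obtain ⟨l, e1, e2⟩ := h.surj s (c k) ⟨hs.1, hk.2.1, hk.2.2.trans (hμ _ _ hs.1 hs.2)⟩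
      exact ⟨l, by simp [e1, e2, hs.2], e1⟩
  · intro k
    have hk := h.mem k
    conv_rhs => rw [show c k = (Icc 1 (c k)).card by simp]
    refine Finset.card_bij (fun l _ => c l) ?_ ?_ ?_
    · intro l hl
      simp only [Finset.mem_filter, Finset.mem_univ, true_and] at hl
      have := (h.mem l).2.1
      simp; omega
    · intro l hl m hm hlm
      simp only [Finset.mem_filter, Finset.mem_univ, true_and] at hl hm
      exact h.inj _ _ (hl.1.trans hm.1.symm) hlm
    · intro s hs
      simp only [Finset.mem_Icc] at hs
      obtain ⟨l, e1, e2⟩ := h.surj (r k) s ⟨hk.1, hs.1, hs.2.trans hk.2.2⟩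
      exact ⟨l, by simp [e1, e2, hs.2], e2⟩

lemma content_eq {S : ℕ → ℕ → Prop} {c r c' r' : Fin n → ℕ} (h : IsTab S c r)
    (h' : IsTab S c' r') : ∑ k, ((c k : F) - (r k : F)) = ∑ k, ((c' k : F) - (r' k : F)) := by
  have e : ∀ {c r : Fin n → ℕ}, IsTab S c r → ∑ k, ((c k : F) - (r k : F)) =
      ∑ x ∈ univ.image (fun k => (r k, c k)), ((x.2 : F) - (x.1 : F)) := by
    intro c r h
    rw [Finset.sum_image]
    intro k _ l _ hkl
    rw [Prod.mk.injEq] at hkl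
    exact h.inj _ _ hkl.1 hkl.2
  rw [e h, e h']
  congr 1
  ext ⟨s, j⟩
  simp only [Finset.mem_image, Finset.mem_univ, true_and, Prod.mk.injEq]
  constructor
  · rintro ⟨k, rfl, rfl⟩; exact h'.surj _ _ (h.mem k)
  · rintro ⟨k, rfl, rfl⟩; exact h.surj _ _ (h'.mem k)

/-! ### Passing between tabloids and functions -/

open Classical in
/-- Embedding of the permutation module in the space of functions. -/
noncomputable def iot (F : Type*) [Field F] {n : ℕ} (c : ℕ → ℕ) : PermMod F n c →ₗ[F] Fn F n where
  toFun x := fun h =>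
    if hh : ∀ i, (Finset.univ.filter fun k => h k = i).card = c i then x ⟨h, hh⟩ else 0
  map_add' x y := by
    funext h
    simp only [Pi.add_apply]
    split_ifs
    · rfl
    · simp
  map_smul' t x := by
    funext h
    simp only [Pi.smul_apply, RingHom.id_apply]
    split_ifs
    · rfl
    · simp

lemma iot_pos {c : ℕ → ℕ} (x : PermMod F n c) (h : Tabloid n c) : iot F c x h.1 = x h :=
  dif_pos h.2

lemma iot_neg {c : ℕ → ℕ} (x : PermMod F n c) (h : Fin n → ℕ)
    (hh : ¬ ∀ i, (Finset.univ.filter fun k => h k = i).card = c i) : iot F c x h = 0 :=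
  dif_neg hh

lemma iot_inj (c : ℕ → ℕ) : Function.Injective (iot F (n := n) c) := by
  intro x y hxy
  refine Finsupp.ext fun h => ?_
  rw [← iot_pos x h, ← iot_pos y h, hxy]

lemma iot_perm {c : ℕ → ℕ} (π : Equiv.Perm (Fin n)) (x : PermMod F n c) :
    iot F c (permM F c π x) = rho F π (iot F c x) := by
  funext h
  rw [rho_apply]
  have hcard : ∀ i, (Finset.univ.filter fun k => h (π k) = i).card =
      (Finset.univ.filter fun k => h k = i).card := fun i =>
    Finset.card_equiv π fun a => by simp
  by_cases hh : ∀ i, (Finset.univ.filter fun k => h k = i).card = c i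
  · have hinj : Function.Injective (permTabloid (n := n) c π) := by
      intro f g hfg
      apply Subtype.ext
      funext k
      have := congrFun (congrArg Subtype.val hfg) (π k)
      simpa [permTabloid] using this
    have e1 := iot_pos (permM F c π x) ⟨h, hh⟩
    have e2 := iot_pos x ⟨fun k => h (π k), fun i => (hcard i).trans (hh i)⟩
    have e3 : (⟨h, hh⟩ : Tabloid n c) =
        permTabloid c π ⟨fun k => h (π k), fun i => (hcard i).trans (hh i)⟩ := by
      apply Subtype.ext
      funext k
      simp [permTabloid]
    rw [e2.trans (Finsupp.mapDomain_apply hinj x _).symm, ← e3]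
    exact e1
  · rw [iot_neg _ _ hh, iot_neg]
    intro h2
    exact hh fun i => (hcard i).symm.trans (h2 i)

lemma iot_poly {μ : Partition n} (T : Placement μ) :
    iot F μ.parts (polytabloid F T) = asym F (fun k => (T.pos k).2) (fun k => (T.pos k).1) := by
  classical
  funext h
  by_cases hh : ∀ i, (Finset.univ.filter fun k => h k = i).card = μ.parts i
  · obtain ⟨H, rfl⟩ : ∃ H : Tabloid n μ.parts, h = H.1 := ⟨⟨h, hh⟩, rfl⟩
    rw [iot_pos, polytabloid, Finsupp.finsetSum_apply, asym]
    refine Finset.sum_congr rfl fun π _ => ?_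
    rw [Finsupp.smul_apply, Finsupp.single_apply, smul_eq_mul, mul_ite, mul_one, mul_zero]
    refine if_congr ?_ rfl rfl
    constructor
    · intro e; exact (congrArg Subtype.val e).symm
    · intro e; exact Subtype.ext e.symm
  · rw [iot_neg _ _ hh]
    by_contra hne
    obtain ⟨π, hπ, rfl⟩ := asym_ne_zero (Ne.symm hne)
    exact hh (rowTabloid T π).2

lemma Placement.isTab {μ : Partition n} (T : Placement μ) :
    IsTab (yd μ.parts) (fun k => (T.pos k).2) (fun k => (T.pos k).1) where
  inj k l h1 h2 := T.inj (Prod.ext h1 h2)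
  mem k := T.mem k
  surj s j h := by
    obtain ⟨k, hk⟩ := T.surj (s, j) h
    exact ⟨k, by rw [hk], by rw [hk]⟩

/-- The placement attached to a tableau. -/
def IsTab.place {μ : Partition n} {c r : Fin n → ℕ} (h : IsTab (yd μ.parts) c r) :
    Placement μ where
  pos k := (r k, c k)
  mem k := h.mem k
  inj k l hkl := by
    rw [Prod.mk.injEq] at hkl
    exact h.inj _ _ hkl.1 hkl.2
  surj x hx := by
    obtain ⟨k, h1, h2⟩ := h.surj x.1 x.2 hx
    exact ⟨k, Prod.ext h1 h2⟩

lemma map_Specht (μ : Partition n) : (Specht F μ).map (iot F μ.parts) =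
    Submodule.span F {v | ∃ c r, IsTab (n := n) (yd μ.parts) c r ∧ v = asym F c r} := by
  rw [Specht, Submodule.map_span]
  congr 1
  ext v
  constructor
  · rintro ⟨_, ⟨T, rfl⟩, rfl⟩
    exact ⟨_, _, T.isTab, iot_poly T⟩
  · rintro ⟨c, r, h, rfl⟩
    exact ⟨_, ⟨h.place, rfl⟩, iot_poly h.place⟩

lemma exists_placement (μ : Partition n) : Nonempty (Placement μ) := by
  classical
  set s : Finset (Σ _ : ℕ, ℕ) := μ.finite_support.toFinset.sigma (fun i => Icc 1 (μ.parts i)) with hs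
  have hmem : ∀ x, x ∈ s ↔ (x.1, x.2) ∈ μ.cells := by
    intro x
    simp only [hs, Finset.mem_sigma, Set.Finite.mem_toFinset, Function.mem_support, Finset.mem_Icc,
      Partition.cells, Set.mem_ofPred_eq]
    constructor
    · rintro ⟨h1, h2, h3⟩
      refine ⟨?_, h2, h3⟩
      rcases Nat.eq_zero_or_pos x.1 with h4 | h4
      · rw [h4, μ.parts_zero] at h1; omega
      · exact h4
    · rintro ⟨h1, h2, h3⟩
      exact ⟨by omega, h2, h3⟩
  have hcard : s.card = n := by
    rw [hs, Finset.card_sigma]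
    simp only [Nat.card_Icc, Nat.add_sub_cancel]
    conv_rhs => rw [← μ.sum_parts]
    rw [finsum_eq_sum_of_support_subset _ (s := μ.finite_support.toFinset) (by simp)]
  let e := s.equivFinOfCardEq hcard
  refine ⟨⟨fun k => ((e.symm k).1.1, (e.symm k).1.2), fun k => ?_, ?_, ?_⟩⟩
  · exact (hmem _).1 (e.symm k).2
  · intro k l hkl
    rw [Prod.mk.injEq] at hkl
    exact e.symm.injective (Subtype.ext (Sigma.ext hkl.1 (heq_of_eq hkl.2)))
  · intro x hx
    refine ⟨e ⟨⟨x.1, x.2⟩, (hmem _).2 hx⟩, by simp⟩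

/-! ### The main argument -/

theorem hom_of_res {γ : ℕ → ℕ} (hγ : ∀ s t, s ≤ t → γ t ≤ γ s) (h0 : γ 1 < γ 0)
    {a b B : ℕ} (ha0 : 0 < a) (hab : a < b) (hbB : b ≤ B) (hB : γ B = 0)
    (ha : γ a < γ (a - 1)) (hb : γ b < γ (b - 1)) (α β : Partition n)
    (hα : yd α.parts = shp γ a) (hβ : yd β.parts = shp γ b)
    (hres : ((γ a : F) + 1) - a = ((γ b : F) + 1) - b) :
    SpechtHom F α β.parts (Specht F β) ≠ ⊥ := by
  have hex : ∃ c r : Fin n → ℕ, IsTab (hat γ (γ 0)) c r := by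
    obtain ⟨T⟩ := exists_placement α
    have h1 := T.isTab
    rw [hα] at h1
    obtain ⟨k0, -, -, h2⟩ := h1.down ha0
    exact ⟨_, _, h2.move (k0 := k0) (by simp) (γ 0)⟩
  obtain ⟨U, hU1, hU2, hU3⟩ := hom_exists (F := F) hγ h0 ha0 hab hbB hB ha hb hres hex
  have mα : (Specht F α).map (iot F α.parts) = SS F n γ a := by rw [map_Specht, hα]; rfl
  have mβ : (Specht F β).map (iot F β.parts) = SS F n γ b := by rw [map_Specht, hβ]; rfl
  obtain ⟨L, hL⟩ := (iot F (n := n) β.parts).exists_leftInverse_of_injective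
    (LinearMap.ker_eq_bot.2 (iot_inj β.parts))
  have hL' : ∀ z, L (iot F β.parts z) = z := fun z => LinearMap.congr_fun hL z
  have hin : ∀ x ∈ Specht F α, iot F α.parts x ∈ SS F n γ a := fun x hx => by
    rw [← mα]; exact Submodule.mem_map_of_mem hx
  set J : Specht F α →ₗ[F] SS F n γ a := (iot F α.parts).restrict hin with hJ
  set f : Specht F α →ₗ[F] PermMod F n β.parts := L ∘ₗ U ∘ₗ J with hf
  have hf1 : ∀ x, ∃ z ∈ Specht F β, iot F β.parts z = U (J x) ∧ f x = z := by
    intro x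
    have := hU1 (J x)
    rw [← mβ] at this
    obtain ⟨z, hz, e⟩ := this
    refine ⟨z, hz, e, ?_⟩
    change L (U (J x)) = z
    rw [← e, hL']
  have hf2 : ∀ x, iot F β.parts (f x) = U (J x) := by
    intro x
    obtain ⟨z, -, e1, e2⟩ := hf1 x
    rw [e2, e1]
  rw [Submodule.ne_bot_iff]
  refine ⟨f, ⟨fun x => ?_, fun π x y hxy => ?_⟩, fun hz => hU3 ?_⟩
  · obtain ⟨z, hz, -, e⟩ := hf1 x
    rw [e]; exact hz
  · apply iot_inj
    rw [iot_perm, hf2, hf2]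
    apply hU2
    change iot F α.parts x = rho F π (iot F α.parts y)
    rw [hxy, iot_perm]
  · ext1 w
    obtain ⟨w, hw⟩ := w
    have hw' := hw
    rw [← mα] at hw'
    obtain ⟨x, hx, rfl⟩ := hw'
    have := hf2 ⟨x, hx⟩
    rw [hz] at this
    simp only [LinearMap.zero_apply, map_zero] at this
    exact this.symm

lemma permM_mem (α : Partition n) (π : Equiv.Perm (Fin n)) :
    ∀ x ∈ Specht F α, permM F α.parts π x ∈ Specht F α := by
  intro x hx
  have h1 : iot F α.parts x ∈ (Specht F α).map (iot F α.parts) := Submodule.mem_map_of_mem hx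
  have h2 : rho F π (iot F α.parts x) ∈ (Specht F α).map (iot F α.parts) := by
    rw [map_Specht] at h1 ⊢
    have : Submodule.span F {v | ∃ c r, IsTab (n := n) (yd α.parts) c r ∧ v = asym F c r} ≤
      (Submodule.span F {v | ∃ c r, IsTab (n := n) (yd α.parts) c r ∧ v = asym F c r}).comap
        (rho F π) := by
      refine Submodule.span_le.2 ?_
      rintro v ⟨c, r, h, rfl⟩
      rw [SetLike.mem_coe, Submodule.mem_comap, rho_asym]
      exact Submodule.subset_span ⟨_, _, h.perm π⁻¹, rfl⟩
    exact this h1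
  obtain ⟨y, hy, e⟩ := h2
  rw [← iot_perm] at e
  rwa [← iot_inj _ e]

lemma iot_ZZ {c : ℕ → ℕ} (x : PermMod F n c) :
    iot F c (∑ k, ∑ l, permM F c (Equiv.swap k l) x) = ZZ F (iot F c x) := by
  funext h
  simp only [map_sum, iot_perm, Finset.sum_apply, rho_apply, ZZ_apply]

lemma ZZ_Specht (β : Partition n) {c r : Fin n → ℕ} (h : IsTab (yd β.parts) c r)
    (x : PermMod F n β.parts) (hx : x ∈ Specht F β) :
    ∑ k, ∑ l, permM F β.parts (Equiv.swap k l) x =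
      ((n : F) + 2 * ∑ k, ((c k : F) - (r k : F))) • x := by
  apply iot_inj
  rw [iot_ZZ, map_smul]
  have h1 : iot F β.parts x ∈ (Specht F β).map (iot F β.parts) := Submodule.mem_map_of_mem hx
  rw [map_Specht] at h1
  have : Submodule.span F {v | ∃ c r, IsTab (n := n) (yd β.parts) c r ∧ v = asym F c r} ≤
      LinearMap.ker (ZZ F (n := n) -
        ((n : F) + 2 * ∑ k, ((c k : F) - (r k : F))) • (LinearMap.id : Fn F n →ₗ[F] Fn F n)) := by
    refine Submodule.span_le.2 ?_
    rintro v ⟨c', r', h', rfl⟩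
    rw [SetLike.mem_coe, LinearMap.mem_ker, LinearMap.sub_apply, LinearMap.smul_apply,
      LinearMap.id_apply, ZZ_tab (fun s t hs hst => β.antitone hs hst) h', content_eq h h', sub_self]
  have := this h1
  rw [LinearMap.mem_ker, LinearMap.sub_apply, LinearMap.smul_apply, LinearMap.id_apply,
    sub_eq_zero] at this
  exact this

theorem res_of_hom {γ : ℕ → ℕ} {a b : ℕ} (ha0 : 0 < a) (hab : a < b) (α β : Partition n)
    (hα : yd α.parts = shp γ a) (hβ : yd β.parts = shp γ b) (h2 : (2 : F) ≠ 0)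
    (hne : SpechtHom F α β.parts (Specht F β) ≠ ⊥) :
    ((γ a : F) + 1) - a = ((γ b : F) + 1) - b := by
  rw [Submodule.ne_bot_iff] at hne
  obtain ⟨f, ⟨hf1, hf2⟩, hf0⟩ := hne
  obtain ⟨x, hx⟩ : ∃ x, f x ≠ 0 := by
    by_contra hcon
    push Not at hcon
    exact hf0 (LinearMap.ext hcon)
  obtain ⟨T⟩ := exists_placement α
  have t1 := T.isTab
  set c := fun k => (T.pos k).2
  set r := fun k => (T.pos k).1
  have t1' := t1
  rw [hα] at t1'
  obtain ⟨k0, hr0, hc0, t2⟩ := t1'.down ha0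
  have t3 := (t2.move (k0 := k0) (by simp) (γ b + 1)).up (a := b) (by omega) (k0 := k0) (by simp)
  rw [← hβ, Function.update_idem] at t3
  have s1 := ZZ_Specht α t1 (x : PermMod F n α.parts) x.2
  have s2 := ZZ_Specht β t3 (f x) (hf1 x)
  have s3 : ∑ k, ∑ l, (⟨permM F α.parts (Equiv.swap k l) x, permM_mem α _ _ x.2⟩ : Specht F α) =
      ((n : F) + 2 * ∑ k, ((c k : F) - (r k : F))) • x := by
    apply Subtype.ext
    rw [Submodule.coe_smul, ← s1]
    simp
  have s4 := congrArg f s3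
  rw [map_smul] at s4
  simp only [map_sum] at s4
  have s5 : ∀ k l, f ⟨permM F α.parts (Equiv.swap k l) x, permM_mem α _ _ x.2⟩ =
      permM F β.parts (Equiv.swap k l) (f x) := fun k l => hf2 _ _ _ rfl
  simp only [s5] at s4
  rw [s2] at s4
  have s6 := smul_left_injective F hx s4
  have s7 := mul_left_cancel₀ h2 (add_left_cancel s6)
  rw [← Finset.add_sum_erase _ _ (Finset.mem_univ k0),
    ← Finset.add_sum_erase (a := k0) _ (fun k => ((c k : F) - (r k : F))) (Finset.mem_univ k0)] at s7
  have s8 : ∑ k ∈ univ.erase k0, (((Function.update c k0 (γ b + 1) k : ℕ) : F) -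
      ((Function.update r k0 b k : ℕ) : F)) = ∑ k ∈ univ.erase k0, ((c k : F) - (r k : F)) := by
    refine Finset.sum_congr rfl fun k hk => ?_
    rw [Function.update_of_ne (Finset.ne_of_mem_erase hk),
      Function.update_of_ne (Finset.ne_of_mem_erase hk)]
  rw [s8] at s7
  have s9 := add_right_cancel s7
  rw [Function.update_self, Function.update_self, hr0, hc0] at s9
  push_cast at s9
  exact s9.symm

theorem main_aux (F : Type*) [Field F] (p : ℕ) [CharP F p] (hp : 2 < p)
    {n : ℕ} (α β : Partition n) (a b : ℕ) (hshift : OneBoxShift α β a b) :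
    SpechtHom F α β.parts (Specht F β) ≠ ⊥ ↔
      (((α.parts a : ℤ) - (a : ℤ) : ℤ) : ZMod p) = (((β.parts b : ℤ) - (b : ℤ) : ℤ) : ZMod p) := by
  obtain ⟨ha0, hab, hrem, hadd, hat_a, hat_b, hels⟩ := hshift
  set δ : ℕ → ℕ := fun s => if s = a then α.parts a - 1 else α.parts s with hδ
  set γ : ℕ → ℕ := fun s => if s = 0 then δ 1 + 1 else δ s with hγd
  have δa : δ a = α.parts a - 1 := by simp [hδ]
  have δo : ∀ s, s ≠ a → δ s = α.parts s := fun s hs => by simp [hδ, hs]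
  have γz : γ 0 = δ 1 + 1 := by simp [hγd]
  have γp : ∀ s, 0 < s → γ s = δ s := fun s hs => by simp only [hγd]; rw [if_neg (by omega)]
  have δanti : ∀ s t, 0 < s → s ≤ t → δ t ≤ δ s := by
    intro s t hs hst
    have h1 := α.antitone hs hst
    by_cases h2 : s = a
    · by_cases h3 : t = a
      · rw [h2, h3]
      · have h4 := α.antitone (i := a + 1) (j := t) (by omega) (by omega)
        rw [h2, δa, δo t h3]; omega
    · by_cases h3 : t = a
      · rw [δo s h2, h3, δa]; rw [h3] at h1; omega
      · rw [δo s h2, δo t h3]; exact h1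
  have hγ : ∀ s t, s ≤ t → γ t ≤ γ s := by
    intro s t hst
    rcases Nat.eq_zero_or_pos s with rfl | hs
    · rcases Nat.eq_zero_or_pos t with rfl | ht
      · exact le_rfl
      · rw [γz, γp t ht]; have := δanti 1 t (by omega) ht; omega
    · rw [γp s hs, γp t (by omega)]; exact δanti s t hs hst
  have h0 : γ 1 < γ 0 := by rw [γz, γp 1 (by omega)]; omega
  have γa : γ a + 1 = α.parts a := by rw [γp a ha0, δa]; omega
  have γb : γ b = α.parts b := by rw [γp b (by omega), δo b (by omega)]
  have hα : yd α.parts = shp γ a := by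
    funext s j
    apply propext
    unfold yd shp
    refine and_congr_right fun hs => and_congr_right fun _ => ?_
    by_cases h1 : s = a
    · rw [h1, if_pos rfl, γa]
    · rw [if_neg h1, γp s hs, δo s h1, add_zero]
  have hβ : yd β.parts = shp γ b := by
    funext s j
    apply propext
    unfold yd shp
    refine and_congr_right fun hs => and_congr_right fun _ => ?_
    by_cases h1 : s = b
    · rw [h1, if_pos rfl, γb, hat_b]
    · rw [if_neg h1, γp s hs, add_zero]
      by_cases h2 : s = a
      · rw [h2, δa, hat_a]
      · rw [δo s h2, hels s h2 h1]
  have ha : γ a < γ (a - 1) := by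
    rcases Nat.eq_zero_or_pos (a - 1) with h1 | h1
    · have : a = 1 := by omega
      subst this; exact h0
    · rw [γp (a - 1) h1, δo _ (by omega)]
      have := α.antitone (i := a - 1) (j := a) h1 (by omega)
      omega
  have hb : γ b < γ (b - 1) := by
    by_cases h1 : b - 1 = a
    · have := β.antitone ha0 hab.le
      rw [h1, γb]; omega
    · rw [γb, γp (b - 1) (by omega), δo _ h1]; exact hadd
  obtain ⟨N, hN⟩ := α.finite_support.bddAbove
  have hB : γ (max (N + 1) b) = 0 := by
    have h1 : b ≤ max (N + 1) b := le_max_right _ _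
    have h2 : N + 1 ≤ max (N + 1) b := le_max_left _ _
    rw [γp _ (by omega), δo _ (by omega)]
    by_contra hne
    have := hN (Function.mem_support.2 hne)
    omega
  have hiff : ((((α.parts a : ℤ) - (a : ℤ) : ℤ) : ZMod p) = (((β.parts b : ℤ) - (b : ℤ) : ℤ) : ZMod p))
      ↔ ((γ a : F) + 1) - a = ((γ b : F) + 1) - b := by
    rw [ZMod.intCast_eq_intCast_iff, ← CharP.intCast_eq_intCast F p, hat_b, ← γa, ← γb]
    push_cast
    rfl
  have h2 : (2 : F) ≠ 0 := by
    intro h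
    have h3 : ((2 : ℕ) : F) = 0 := by exact_mod_cast h
    rw [CharP.cast_eq_zero_iff F p] at h3
    have := Nat.le_of_dvd (by omega) h3
    omega
  rw [hiff]
  exact ⟨res_of_hom ha0 hab α β hα hβ h2,
    hom_of_res hγ h0 ha0 hab (le_max_right _ _) hB ha hb α β hα hβ⟩

end Aux

/-- Let `F` be a field of characteristic `p > 2`, let `α` be a partition
of `n`, and let `β` be a one-box-shift of `α` with `β_a = α_a - 1` and `β_b = α_b + 1` for
`a < b`.  Then `Hom_{FΣ_n}(S^α, S^β) ≠ 0` if and only if `α_a - a ≡ β_b - b (mod p)`,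
i.e. iff the removed node `(a, α_a)` and the added node `(b, β_b)` have the same
`p`-residue. -/
theorem stmt17 (F : Type*) [Field F] (p : ℕ) [CharP F p] (hp : 2 < p)
    {n : ℕ} (α β : Partition n) (a b : ℕ) (hshift : OneBoxShift α β a b) :
    SpechtHom F α β.parts (Specht F β) ≠ ⊥ ↔
      (((α.parts a : ℤ) - (a : ℤ) : ℤ) : ZMod p) = (((β.parts b : ℤ) - (b : ℤ) : ℤ) : ZMod p) := by
  exact main_aux F p hp α β a b hshift

end CarterPayne
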